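/- arXiv:1512.07219 — 3 statements merged into one kernel-verified Lean document; each statement's English description precedes it below -/
import Mathlib

section
/- Let $T>0$ and $H\in(\tfrac23,1)$. Then $\lim_{\varepsilon\to0^+}\varepsilon^{3-\frac2H}\, V_1(\varepsilon) = 0$, where $V_1(\varepsilon) := \frac1\pi\int_{\mathcal{S}_1} \big((\varepsilon+\Sigma_{11})(\varepsilon+\Sigma_{22})-\Sigma_{12}^2\big)^{-3/2}\,\Sigma_{12}\; ds_1\, ds_2\, dt_1\, dt_2$. -/
open Real Set MeasureTheory Filter

/-- The covariance `𝔼[B_{u₁}(B_{x+u₂} - B_x)]` of a fractional Brownian motion of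
Hurst parameter `H`. -/
noncomputable def mu (H x u₁ u₂ : ℝ) : ℝ :=
  (1/2) * ((x + u₂) ^ (2*H) - x ^ (2*H) - |x + u₂ - u₁| ^ (2*H) + |x - u₁| ^ (2*H))

/-- The region `𝒮₁ = {(s₁,s₂,t₁,t₂) ∈ [0,T]⁴ : s₁ ≤ s₂ ≤ t₁ ≤ t₂}`. -/
def regS1 (T : ℝ) : Set (ℝ × ℝ × ℝ × ℝ) :=
  {p | p.1 ∈ Icc (0:ℝ) T ∧ p.2.1 ∈ Icc (0:ℝ) T ∧ p.2.2.1 ∈ Icc (0:ℝ) T ∧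
    p.2.2.2 ∈ Icc (0:ℝ) T ∧ p.1 ≤ p.2.1 ∧ p.2.1 ≤ p.2.2.1 ∧ p.2.2.1 ≤ p.2.2.2}

/-- `V₁(ε)`, the contribution of the region `𝒮₁` to `𝔼[α_ε²]`: the integral over `𝒮₁` of
`det(εI + Σ)^{-3/2} Σ₁₂ / π`, where `Σ` is the covariance matrix of
`(B_{t₁}-B_{s₁}, B_{t₂}-B_{s₂})`. -/
noncomputable def V1 (H T ε : ℝ) : ℝ :=
  (1/π) * ∫ p in regS1 T,
    ((ε + (p.2.2.1 - p.1) ^ (2*H)) * (ε + (p.2.2.2 - p.2.1) ^ (2*H)) -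
        mu H (p.2.1 - p.1) (p.2.2.1 - p.1) (p.2.2.2 - p.2.1) ^ 2) ^ (-(3/2 : ℝ)) *
      mu H (p.2.1 - p.1) (p.2.2.1 - p.1) (p.2.2.2 - p.2.1)

lemma rpow_add_le_of_le {q t u v : ℝ} (hq0 : 0 < q) (hq1 : q < 1) (ht : 0 ≤ t) (hu : 0 < u)
    (hv : 0 < v) (htu : t ≤ u) (htv : t ≤ v) :
    (u + v) ^ q ≤ u ^ q + v ^ q - (1 - q) * t ^ q := by
  have key : ∀ {u v : ℝ}, 0 < v → v ≤ u → (u + v) ^ q ≤ u ^ q + q * v ^ q := by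
    intro u v hv huv
    have hu : 0 < u := hv.trans_le huv
    have hb : (1 + v / u) ^ q ≤ 1 + q * (v / u) :=
      rpow_one_add_le_one_add_mul_self (by linarith [div_pos hv hu]) hq0.le hq1.le
    have hmul : u ^ q * (v / u) ≤ v ^ q := by
      have h1 : v / u ≤ (v / u) ^ q := by
        simpa using Real.rpow_le_rpow_of_exponent_ge (div_pos hv hu)
          ((div_le_one hu).2 huv) hq1.le
      have h2 : v ^ q = u ^ q * (v / u) ^ q := by
        rw [← Real.mul_rpow hu.le (div_pos hv hu).le, mul_div_cancel₀ _ hu.ne']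
      rw [h2]
      gcongr
    calc (u + v) ^ q = u ^ q * (1 + v / u) ^ q := by
          rw [← Real.mul_rpow hu.le (by positivity)]
          congr 1
          field_simp
      _ ≤ u ^ q * (1 + q * (v / u)) := by gcongr
      _ = u ^ q + q * (u ^ q * (v / u)) := by ring
      _ ≤ u ^ q + q * v ^ q := by gcongr
  rcases le_total v u with h | h
  · have h1 := key hv h
    have h2 : t ^ q ≤ v ^ q := by gcongr
    nlinarith
  · have h1 := key hu h
    rw [add_comm v u] at h1
    have h2 : t ^ q ≤ u ^ q := by gcongr
    nlinarith

lemma rpow_add_add_rpow_sub_le {q m d : ℝ} (hq0 : 0 ≤ q) (hq1 : q ≤ 1) (hd : 0 ≤ d) (hdm : d ≤ m) :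
    (m + d) ^ q + (m - d) ^ q ≤ 2 * m ^ q := by
  have h := (Real.concaveOn_rpow hq0 hq1).2 (mem_Ici.2 (show 0 ≤ m + d by linarith))
    (mem_Ici.2 (show 0 ≤ m - d by linarith)) (show (0 : ℝ) ≤ 1 / 2 by norm_num)
    (show (0 : ℝ) ≤ 1 / 2 by norm_num) (by norm_num)
  simp only [smul_eq_mul] at h
  rw [show 1 / 2 * (m + d) + 1 / 2 * (m - d) = m by ring] at h
  linarith

lemma rpow_two_mul_eq {x : ℝ} (hx : 0 ≤ x) (q : ℝ) : x ^ (2 * q) = (x ^ 2) ^ q := by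
  rw [Real.rpow_mul hx, Real.rpow_two]

lemma increments_cov_le {q a b c t u : ℝ} (hq0 : 0 < q) (hq1 : q < 1) (ha : 0 < a) (hb : 0 < b)
    (hc : 0 < c) (ht : 0 ≤ t) (hu : 0 ≤ u) (hta : t ≤ a ^ 2) (htm : t ≤ (a + b) * (b + c))
    (huc : u ≤ c ^ 2) (hum : u ≤ (a + b) * (b + c)) :
    (a + b + c) ^ (2 * q) + b ^ (2 * q) - a ^ (2 * q) - c ^ (2 * q) ≤
      2 * ((a + b) * (b + c)) ^ q - (1 - q) * (t ^ q + u ^ q) := by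
  have hab := mul_pos ha hb
  have hac := mul_pos ha hc
  have hbc := mul_pos hb hc
  set m := (a + b) * (b + c) with hm
  set d := a * b + b * c + a * c with hd
  have hm0 : 0 < m := by positivity
  have hd0 : 0 < d := by positivity
  rw [rpow_two_mul_eq (by positivity), rpow_two_mul_eq hb.le, rpow_two_mul_eq ha.le,
    rpow_two_mul_eq hc.le, show (a + b + c) ^ 2 = m + d + a ^ 2 + c ^ 2 by rw [hm, hd]; ring,
    show b ^ 2 = m - d by rw [hm, hd]; ring]
  have h1 := rpow_add_add_rpow_sub_le hq0.le hq1.le hd0.le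
    (show d ≤ m by rw [hm, hd]; nlinarith [sq_nonneg b])
  have h2 := rpow_add_le_of_le hq0 hq1 ht (add_pos hm0 hd0) (pow_pos ha 2) (by linarith) hta
  have h3 := rpow_add_le_of_le hq0 hq1 hu (u := m + d + a ^ 2) (by positivity) (pow_pos hc 2)
    (by nlinarith) huc
  linarith

lemma mu_increments {H a b c : ℝ} (hb : 0 ≤ b) (hc : 0 ≤ c) :
    mu H a (a + b) (b + c) =
      1 / 2 * ((a + b + c) ^ (2 * H) + b ^ (2 * H) - a ^ (2 * H) - c ^ (2 * H)) := by
  unfold mu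
  rw [show a + (b + c) - (a + b) = c by ring, show a - (a + b) = -b by ring, abs_neg,
    abs_of_nonneg hb, abs_of_nonneg hc, ← add_assoc]
  ring

lemma mu_increments_symm {H a b c : ℝ} (ha : 0 ≤ a) (hb : 0 ≤ b) (hc : 0 ≤ c) :
    mu H c (c + b) (b + a) = mu H a (a + b) (b + c) := by
  rw [mu_increments hb ha, mu_increments hb hc, show c + b + a = a + b + c by ring]
  ring

lemma mu_increments_nonneg {H a b c : ℝ} (hH : 1 / 2 ≤ H) (ha : 0 ≤ a) (hb : 0 ≤ b)
    (hc : 0 ≤ c) : 0 ≤ mu H a (a + b) (b + c) := by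
  rw [mu_increments hb hc]
  have h1 := Real.add_rpow_le_rpow_add ha hc (show 1 ≤ 2 * H by linarith)
  have h2 : (a + c) ^ (2 * H) ≤ (a + b + c) ^ (2 * H) :=
    Real.rpow_le_rpow (by positivity) (by linarith) (by linarith)
  have h3 : 0 ≤ b ^ (2 * H) := by positivity
  linarith

/-- The determinant of `ε I + Σ` for consecutive lengths `a = s₂ - s₁`, `b = t₁ - s₂`,
`c = t₂ - t₁`. -/
noncomputable def incrDet (H ε a b c : ℝ) : ℝ :=
  (ε + (a + b) ^ (2 * H)) * (ε + (b + c) ^ (2 * H)) - mu H a (a + b) (b + c) ^ 2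

lemma incrDet_symm {H ε a b c : ℝ} (ha : 0 ≤ a) (hb : 0 ≤ b) (hc : 0 ≤ c) :
    incrDet H ε c b a = incrDet H ε a b c := by
  rw [incrDet, incrDet, mu_increments_symm ha hb hc, add_comm c b, add_comm b a]
  ring

lemma mu_increments_le {H a b c : ℝ} (hH0 : 0 < H) (hH1 : H < 1) (ha : 0 < a)
    (hb : 0 < b) (hc : 0 < c) : mu H a (a + b) (b + c) ≤ ((a + b) * (b + c)) ^ H := by
  have h := increments_cov_le hH0 hH1 ha hb hc le_rfl le_rfl (by positivity) (by positivity)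
    (by positivity) (by positivity)
  rw [Real.zero_rpow hH0.ne'] at h
  rw [mu_increments hb.le hc.le]
  linarith

lemma mu_increments_le_of_le {H a b c z : ℝ} (hH0 : 0 < H) (hH1 : H < 1) (ha : 0 < a)
    (hb : 0 < b) (hc : 0 < c) (haz : a ≤ z) (hbz : b ≤ z) (hcz : c ≤ z) :
    mu H a (a + b) (b + c) ≤ 4 * z ^ (2 * H) := by
  have hz : 0 < z := ha.trans_le haz
  calc mu H a (a + b) (b + c) ≤ ((a + b) * (b + c)) ^ H := mu_increments_le hH0 hH1 ha hb hc
    _ ≤ ((2 * z) * (2 * z)) ^ H := by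
        refine Real.rpow_le_rpow (by positivity) ?_ hH0.le
        exact mul_le_mul (by linarith) (by linarith) (by positivity) (by positivity)
    _ = 4 ^ H * z ^ (2 * H) := by
        rw [rpow_two_mul_eq hz.le, ← Real.mul_rpow (by norm_num) (by positivity)]
        congr 1
        ring
    _ ≤ 4 * z ^ (2 * H) := by
        gcongr
        simpa using Real.rpow_le_rpow_of_exponent_le (show (1 : ℝ) ≤ 4 by norm_num) hH1.le

lemma le_incrDet {H ε a b c t u : ℝ} (hH : 1 / 2 ≤ H) (hH1 : H < 1) (ha : 0 < a)
    (hb : 0 < b) (hc : 0 < c) (ht : 0 ≤ t) (hu : 0 ≤ u) (hta : t ≤ a ^ 2)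
    (htm : t ≤ (a + b) * (b + c)) (huc : u ≤ c ^ 2) (hum : u ≤ (a + b) * (b + c)) :
    ε * (a + b) ^ (2 * H) + ε * (b + c) ^ (2 * H) +
      ((a + b) * (b + c)) ^ H * ((1 - H) / 2 * (t ^ H + u ^ H)) ≤ incrDet H ε a b c := by
  have hH0 : 0 < H := by linarith
  have h := increments_cov_le hH0 hH1 ha hb hc ht hu hta htm huc hum
  have hmu := mu_increments (H := H) (a := a) hb.le hc.le
  have h0 := mu_increments_nonneg hH ha.le hb.le hc.le
  have hle := mu_increments_le hH0 hH1 ha hb hc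
  have hsq : (a + b) ^ (2 * H) * (b + c) ^ (2 * H) = (((a + b) * (b + c)) ^ H) ^ 2 := by
    rw [← Real.mul_rpow (by positivity) (by positivity), rpow_two_mul_eq (by positivity),
      ← Real.rpow_natCast, ← Real.rpow_natCast, ← Real.rpow_mul (by positivity),
      ← Real.rpow_mul (by positivity), mul_comm H]
  rw [incrDet]
  set M := mu H a (a + b) (b + c)
  set Q := ((a + b) * (b + c)) ^ H
  have hQ : 0 ≤ Q := h0.trans hle
  have hgap : Q * ((1 - H) / 2 * (t ^ H + u ^ H)) ≤ Q * (Q - M) := by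
    gcongr
    linarith
  nlinarith [sq_nonneg ε, mul_nonneg h0 (sub_nonneg.2 hle)]

lemma le_incrDet_middle {H ε a b c : ℝ} (hH : 1 / 2 ≤ H) (hH1 : H < 1) (hε : 0 < ε) (ha : 0 < a)
    (hb : 0 < b) (hc : 0 < c) (hab : a ≤ b) (hcb : c ≤ b) :
    (1 - H) / 4 * b ^ (2 * H) * (ε + max a c ^ (2 * H)) ≤ incrDet H ε a b c := by
  have hH0 : 0 < H := by linarith
  have hac := mul_pos ha hc
  have hbab := mul_pos ha hb
  have hbcb := mul_pos hb hc
  have h := le_incrDet (ε := ε) hH hH1 ha hb hc (sq_nonneg a) (sq_nonneg c) le_rfl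
    (by nlinarith) le_rfl (by nlinarith)
  rw [← rpow_two_mul_eq ha.le, ← rpow_two_mul_eq hc.le] at h
  have hQ : b ^ (2 * H) ≤ ((a + b) * (b + c)) ^ H := by
    rw [rpow_two_mul_eq hb.le]
    exact Real.rpow_le_rpow (by positivity) (by nlinarith) hH0.le
  have hA : b ^ (2 * H) ≤ (a + b) ^ (2 * H) :=
    Real.rpow_le_rpow hb.le (by linarith) (by linarith)
  have hmax : max a c ^ (2 * H) ≤ a ^ (2 * H) + c ^ (2 * H) := by
    have := Real.rpow_nonneg ha.le (2 * H)
    have := Real.rpow_nonneg hc.le (2 * H)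
    rcases max_choice a c with h | h <;> rw [h] <;> linarith
  refine le_trans ?_ h
  have hk : 0 < 1 - H := by linarith
  have h1 : (1 - H) / 4 * b ^ (2 * H) * ε ≤ ε * (a + b) ^ (2 * H) := by
    calc (1 - H) / 4 * b ^ (2 * H) * ε ≤ 1 * (a + b) ^ (2 * H) * ε := by
          gcongr
          linarith
      _ = _ := by ring
  have h2 : (1 - H) / 4 * b ^ (2 * H) * max a c ^ (2 * H) ≤
      ((a + b) * (b + c)) ^ H * ((1 - H) / 2 * (a ^ (2 * H) + c ^ (2 * H))) := by
    calc (1 - H) / 4 * b ^ (2 * H) * max a c ^ (2 * H)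
        = b ^ (2 * H) * ((1 - H) / 4 * max a c ^ (2 * H)) := by ring
      _ ≤ ((a + b) * (b + c)) ^ H * ((1 - H) / 2 * (a ^ (2 * H) + c ^ (2 * H))) := by
          gcongr
          linarith
  have h3 : 0 ≤ ε * (b + c) ^ (2 * H) := by positivity
  linarith

lemma le_incrDet_left {H ε a b c : ℝ} (hH : 1 / 2 ≤ H) (hH1 : H < 1) (hε : 0 < ε) (ha : 0 < a)
    (hb : 0 < b) (hc : 0 < c) (hba : b ≤ a) (hca : c ≤ a) :
    (1 - H) / 4 * a ^ (2 * H) * (ε + max b c ^ (2 * H)) ≤ incrDet H ε a b c := by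
  have hH0 : 0 < H := by linarith
  have hk : 0 < 1 - H := by linarith
  have hac := mul_pos ha hc
  have hbab := mul_pos ha hb
  have hbcb := mul_pos hb hc
  have hn : max b c ≤ b + c := max_le (by linarith) (by linarith)
  have hn0 : 0 < max b c := lt_max_of_lt_left hb
  have hna : max b c ≤ a := max_le hba hca
  have h := le_incrDet (ε := ε) (t := a * max b c) (u := 0) hH hH1 ha hb hc
    (by positivity) le_rfl (by nlinarith)
    (mul_le_mul (by linarith) hn hn0.le (by positivity)) (by positivity) (by positivity)
  rw [Real.zero_rpow hH0.ne', add_zero] at h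
  have hQ : (a * max b c) ^ H ≤ ((a + b) * (b + c)) ^ H :=
    Real.rpow_le_rpow (by positivity)
      (mul_le_mul (by linarith) hn hn0.le (by positivity)) hH0.le
  have hA : a ^ (2 * H) ≤ (a + b) ^ (2 * H) :=
    Real.rpow_le_rpow ha.le (by linarith) (by linarith)
  have hsq : a ^ (2 * H) * max b c ^ (2 * H) = (a * max b c) ^ H * (a * max b c) ^ H := by
    rw [← Real.mul_rpow ha.le hn0.le, two_mul, Real.rpow_add (by positivity)]
  refine le_trans ?_ h
  have h1 : (1 - H) / 4 * a ^ (2 * H) * ε ≤ ε * (a + b) ^ (2 * H) := by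
    calc (1 - H) / 4 * a ^ (2 * H) * ε ≤ 1 * (a + b) ^ (2 * H) * ε := by
          gcongr
          linarith
      _ = _ := by ring
  have h2 : (1 - H) / 4 * a ^ (2 * H) * max b c ^ (2 * H) ≤
      ((a + b) * (b + c)) ^ H * ((1 - H) / 2 * (a * max b c) ^ H) := by
    rw [mul_assoc, hsq]
    calc (1 - H) / 4 * ((a * max b c) ^ H * (a * max b c) ^ H)
        = (a * max b c) ^ H * ((1 - H) / 4 * (a * max b c) ^ H) := by ring
      _ ≤ ((a + b) * (b + c)) ^ H * ((1 - H) / 2 * (a * max b c) ^ H) := by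
          gcongr
          linarith
  have h3 : 0 ≤ ε * (b + c) ^ (2 * H) := by positivity
  linarith

lemma rpow_mul_le_of_le {H ε k x y z D M : ℝ} (hH : H ∈ Ioo (2 / 3 : ℝ) 1) (hε : 0 < ε)
    (hk : 0 < k) (hx : 0 < x) (hy : 0 < y) (hz : 0 < z) (hM : M ≤ 4 * z ^ (2 * H))
    (hD : k * z ^ (2 * H) * (ε + max x y ^ (2 * H)) ≤ D) :
    D ^ (-(3 / 2 : ℝ)) * M ≤ 4 * k ^ (-(3 / 2 : ℝ)) * ε ^ (-(9 / 4 - 3 / (2 * H))) *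
      (z ^ (-H) * x ^ (-(3 / 2 - 3 * H / 4)) * y ^ (-(3 / 2 - 3 * H / 4))) := by
  obtain ⟨hH0, hH1⟩ := hH
  have hHpos : 0 < H := by linarith
  have hθ0 : 0 ≤ 1 / H - 1 / 2 := by
    have := (one_le_div hHpos).2 hH1.le
    linarith
  have hθ1 : 0 ≤ 3 / 2 - 1 / H := by
    have : 1 / H ≤ 3 / 2 := by rw [div_le_iff₀ hHpos]; linarith
    linarith
  have hn : 0 < max x y := lt_max_of_lt_left hx
  have hN : 0 < max x y ^ (2 * H) := by positivity
  have hxy : x * y ≤ max x y * max x y :=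
    mul_le_mul (le_max_left _ _) (le_max_right _ _) hy.le hn.le
  have hgeom : ε ^ (3 / 2 - 1 / H) * (x * y) ^ (1 - H / 2) ≤ ε + max x y ^ (2 * H) := by
    calc ε ^ (3 / 2 - 1 / H) * (x * y) ^ (1 - H / 2)
        ≤ ε ^ (3 / 2 - 1 / H) * (max x y * max x y) ^ (1 - H / 2) := by
          gcongr
          linarith
      _ = ε ^ (3 / 2 - 1 / H) * (max x y ^ (2 * H)) ^ (1 / H - 1 / 2) := by
          rw [← sq, ← Real.rpow_two, ← Real.rpow_mul hn.le, ← Real.rpow_mul hn.le]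
          congr 2
          field_simp
      _ ≤ (ε + max x y ^ (2 * H)) ^ (3 / 2 - 1 / H) *
            (ε + max x y ^ (2 * H)) ^ (1 / H - 1 / 2) := by
          gcongr <;> linarith
      _ = ε + max x y ^ (2 * H) := by
          rw [← Real.rpow_add (by positivity)]
          ring_nf
          simp
  have hL : k * z ^ (2 * H) * (ε ^ (3 / 2 - 1 / H) * (x * y) ^ (1 - H / 2)) ≤ D :=
    le_trans (by gcongr) hD
  have hL0 : 0 < k * z ^ (2 * H) * (ε ^ (3 / 2 - 1 / H) * (x * y) ^ (1 - H / 2)) := by positivity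
  have hD0 : 0 < D := hL0.trans_le hL
  calc D ^ (-(3 / 2 : ℝ)) * M ≤ D ^ (-(3 / 2 : ℝ)) * (4 * z ^ (2 * H)) := by gcongr
    _ ≤ (k * z ^ (2 * H) * (ε ^ (3 / 2 - 1 / H) * (x * y) ^ (1 - H / 2))) ^ (-(3 / 2 : ℝ)) *
          (4 * z ^ (2 * H)) := by
        gcongr ?_ * _
        exact Real.rpow_le_rpow_of_nonpos hL0 hL (by norm_num)
    _ = 4 * k ^ (-(3 / 2 : ℝ)) * ε ^ ((3 / 2 - 1 / H) * -(3 / 2)) *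
          (z ^ (2 * H * -(3 / 2) + 2 * H) * x ^ ((1 - H / 2) * -(3 / 2)) *
            y ^ ((1 - H / 2) * -(3 / 2))) := by
        rw [Real.mul_rpow (by positivity) (by positivity), Real.mul_rpow hk.le (by positivity),
          Real.mul_rpow (by positivity) (by positivity), ← Real.rpow_mul hz.le,
          ← Real.rpow_mul hε.le, ← Real.rpow_mul (by positivity), Real.mul_rpow hx.le hy.le,
          Real.rpow_add hz]
        ring
    _ = _ := by
        rw [show (3 / 2 - 1 / H) * -(3 / 2) = -(9 / 4 - 3 / (2 * H)) by field_simp; ring,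
          show 2 * H * -(3 / 2) + 2 * H = -H by ring,
          show (1 - H / 2) * -(3 / 2) = -(3 / 2 - 3 * H / 4) by ring]

lemma integrand_le {H ε a b c : ℝ} (hH : H ∈ Ioo (2 / 3 : ℝ) 1) (hε : 0 < ε) (ha : 0 < a)
    (hb : 0 < b) (hc : 0 < c) :
    ‖incrDet H ε a b c ^ (-(3 / 2 : ℝ)) * mu H a (a + b) (b + c)‖ ≤
      4 * ((1 - H) / 4) ^ (-(3 / 2 : ℝ)) * ε ^ (-(9 / 4 - 3 / (2 * H))) *
        (a ^ (-H) * b ^ (-(3 / 2 - 3 * H / 4)) * c ^ (-(3 / 2 - 3 * H / 4)) +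
          a ^ (-(3 / 2 - 3 * H / 4)) * b ^ (-H) * c ^ (-(3 / 2 - 3 * H / 4)) +
          a ^ (-(3 / 2 - 3 * H / 4)) * b ^ (-(3 / 2 - 3 * H / 4)) * c ^ (-H)) := by
  have hH' := hH
  obtain ⟨hH0, hH1⟩ := hH'
  have hHpos : 0 < H := by linarith
  have hH2 : 1 / 2 ≤ H := by linarith
  have hk : 0 < (1 - H) / 4 := by linarith
  have hM0 := mu_increments_nonneg hH2 ha.le hb.le hc.le
  have main : ∀ {x y z : ℝ}, 0 < x → 0 < y → 0 < z → a ≤ z → b ≤ z → c ≤ z →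
      (1 - H) / 4 * z ^ (2 * H) * (ε + max x y ^ (2 * H)) ≤ incrDet H ε a b c →
      ‖incrDet H ε a b c ^ (-(3 / 2 : ℝ)) * mu H a (a + b) (b + c)‖ ≤
        4 * ((1 - H) / 4) ^ (-(3 / 2 : ℝ)) * ε ^ (-(9 / 4 - 3 / (2 * H))) *
          (z ^ (-H) * x ^ (-(3 / 2 - 3 * H / 4)) * y ^ (-(3 / 2 - 3 * H / 4))) := by
    intro x y z hx hy hz haz hbz hcz hD
    have hn : 0 < max x y := lt_max_of_lt_left hx
    have hD0 : 0 ≤ incrDet H ε a b c := le_trans (by positivity) hD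
    rw [Real.norm_of_nonneg (by positivity)]
    exact rpow_mul_le_of_le hH hε hk hx hy hz
      (mu_increments_le_of_le hHpos hH1 ha hb hc haz hbz hcz) hD
  have hA : 0 ≤ a ^ (-H) * b ^ (-(3 / 2 - 3 * H / 4)) * c ^ (-(3 / 2 - 3 * H / 4)) := by positivity
  have hB : 0 ≤ a ^ (-(3 / 2 - 3 * H / 4)) * b ^ (-H) * c ^ (-(3 / 2 - 3 * H / 4)) := by positivity
  have hC : 0 ≤ a ^ (-(3 / 2 - 3 * H / 4)) * b ^ (-(3 / 2 - 3 * H / 4)) * c ^ (-H) := by positivity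
  have largest : (b ≤ a ∧ c ≤ a) ∨ (a ≤ b ∧ c ≤ b) ∨ (a ≤ c ∧ b ≤ c) := by grind
  rcases largest with ⟨h1, h2⟩ | ⟨h1, h2⟩ | ⟨h1, h2⟩
  · refine (main hb hc ha le_rfl h1 h2
      (le_incrDet_left hH2 hH1 hε ha hb hc h1 h2)).trans ?_
    gcongr
    linarith
  · refine (main ha hc hb h1 le_rfl h2
      (le_incrDet_middle hH2 hH1 hε ha hb hc h1 h2)).trans ?_
    gcongr
    linarith
  · have hdet := le_incrDet_left hH2 hH1 hε hc hb ha h2 h1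
    rw [incrDet_symm ha.le hb.le hc.le] at hdet
    refine (main hb ha hc h1 h2 le_rfl hdet).trans ?_
    gcongr
    linarith

/-- The weight `u ^ (-r)` on `[0, T]`, with value `∞` at `0` when `0 < r`. -/
noncomputable def powWeight (T r : ℝ) : ℝ → ENNReal :=
  (Icc 0 T).indicator fun u => ENNReal.ofReal u ^ (-r)

lemma measurable_powWeight (T r : ℝ) : Measurable (powWeight T r) :=
  (ENNReal.measurable_ofReal.pow_const _).indicator measurableSet_Icc

lemma powWeight_of_pos {T r u : ℝ} (hu : 0 < u) (huT : u ≤ T) :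
    powWeight T r u = ENNReal.ofReal (u ^ (-r)) := by
  rw [powWeight, indicator_of_mem (show u ∈ Icc 0 T from ⟨hu.le, huT⟩), ENNReal.ofReal_rpow_of_pos hu]

lemma powWeight_zero {T r : ℝ} (hT : 0 ≤ T) (hr : 0 < r) : powWeight T r 0 = ⊤ := by
  rw [powWeight, indicator_of_mem (left_mem_Icc.2 hT)]
  simp [ENNReal.zero_rpow_of_neg, hr]

lemma powWeight_ne_zero {T r u : ℝ} (hr : 0 < r) (hu : u ∈ Icc 0 T) : powWeight T r u ≠ 0 := by
  rcases hu.1.eq_or_lt with rfl | h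
  · simp [powWeight_zero hu.2 hr]
  · rw [powWeight_of_pos h hu.2]
    simpa using Real.rpow_pos_of_pos h (-r)

lemma lintegral_powWeight_ne_top {T r : ℝ} (hT : 0 ≤ T) (hr : r < 1) :
    ∫⁻ u, powWeight T r u ≠ ⊤ := by
  have hint : IntegrableOn (fun u : ℝ => u ^ (-r)) (Ioc 0 T) :=
    (intervalIntegrable_iff_integrableOn_Ioc_of_le hT).1
      (intervalIntegral.intervalIntegrable_rpow' (by linarith))
  rw [powWeight, lintegral_indicator measurableSet_Icc, ← setLIntegral_congr Ioc_ae_eq_Icc,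
    setLIntegral_congr_fun (g := fun u => ENNReal.ofReal (u ^ (-r))) measurableSet_Ioc
      fun u hu => ENNReal.ofReal_rpow_of_pos hu.1]
  exact hint.lintegral_lt_top.ne

lemma lintegral_shift_mul {β : Type*} [MeasurableSpace β] {ν : Measure β} [SFinite ν]
    {g : ℝ → ENNReal} {F : ℝ × β → ENNReal} {K : ENNReal} (hg : Measurable g) (hF : Measurable F)
    (hK : ∀ y, ∫⁻ q, F (y, q) ∂ν = K) (x : ℝ) :
    ∫⁻ p : ℝ × β, g (p.1 - x) * F p ∂(volume.prod ν) = (∫⁻ u, g u) * K := by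
  rw [lintegral_prod _ (by fun_prop)]
  have inner : ∀ y, ∫⁻ q, g (y - x) * F (y, q) ∂ν = g (y - x) * K := fun y => by
    rw [lintegral_const_mul _ (by fun_prop), hK]
  simp_rw [inner]
  rw [lintegral_mul_const _ (by fun_prop), lintegral_sub_right_eq_self g x]

lemma lintegral_chain {g₀ g₁ g₂ g₃ : ℝ → ENNReal} (h₀ : Measurable g₀) (h₁ : Measurable g₁)
    (h₂ : Measurable g₂) (h₃ : Measurable g₃) :
    ∫⁻ p : ℝ × ℝ × ℝ × ℝ, g₀ p.1 * (g₁ (p.2.1 - p.1) * (g₂ (p.2.2.1 - p.2.1) *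
      g₃ (p.2.2.2 - p.2.2.1))) =
      (∫⁻ u, g₀ u) * ((∫⁻ u, g₁ u) * ((∫⁻ u, g₂ u) * ∫⁻ u, g₃ u)) := by
  have e₂ := lintegral_shift_mul (F := fun q : ℝ × ℝ => g₃ (q.2 - q.1)) h₂ (by fun_prop)
    (fun y => lintegral_sub_right_eq_self (μ := volume) g₃ y)
  have e₁ := lintegral_shift_mul
    (F := fun q : ℝ × ℝ × ℝ => g₂ (q.2.1 - q.1) * g₃ (q.2.2 - q.2.1)) h₁ (by fun_prop) e₂
  have e₀ := lintegral_shift_mul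
    (F := fun q : ℝ × ℝ × ℝ × ℝ => g₁ (q.2.1 - q.1) * (g₂ (q.2.2.1 - q.2.1) *
      g₃ (q.2.2.2 - q.2.2.1))) h₀ (by fun_prop) e₁ 0
  simp only [sub_zero] at e₀
  exact e₀

/-- The product of power weights in the consecutive gaps of `(s₁, s₂, t₁, t₂)`. -/
noncomputable def chainWeight (T r₁ r₂ r₃ : ℝ) (p : ℝ × ℝ × ℝ × ℝ) : ENNReal :=
  (Icc 0 T).indicator 1 p.1 * (powWeight T r₁ (p.2.1 - p.1) *
    (powWeight T r₂ (p.2.2.1 - p.2.1) * powWeight T r₃ (p.2.2.2 - p.2.2.1)))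

lemma measurable_chainWeight (T r₁ r₂ r₃ : ℝ) : Measurable (chainWeight T r₁ r₂ r₃) := by
  have h₀ : Measurable ((Icc 0 T).indicator (1 : ℝ → ENNReal)) :=
    measurable_one.indicator measurableSet_Icc
  have h := measurable_powWeight T
  unfold chainWeight
  fun_prop

lemma lintegral_chainWeight_ne_top {T r₁ r₂ r₃ : ℝ} (hT : 0 ≤ T) (h₁ : r₁ < 1) (h₂ : r₂ < 1)
    (h₃ : r₃ < 1) : ∫⁻ p, chainWeight T r₁ r₂ r₃ p ≠ ⊤ := by
  unfold chainWeight
  rw [lintegral_chain (measurable_one.indicator measurableSet_Icc) (measurable_powWeight _ _)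
    (measurable_powWeight _ _) (measurable_powWeight _ _), lintegral_indicator_one measurableSet_Icc]
  refine ENNReal.mul_ne_top (by simp) (ENNReal.mul_ne_top (lintegral_powWeight_ne_top hT h₁)
    (ENNReal.mul_ne_top (lintegral_powWeight_ne_top hT h₂) (lintegral_powWeight_ne_top hT h₃)))

lemma chainWeight_of_pos {T r₁ r₂ r₃ : ℝ} {p : ℝ × ℝ × ℝ × ℝ} (hp : p ∈ regS1 T)
    (ha : p.1 < p.2.1) (hb : p.2.1 < p.2.2.1) (hc : p.2.2.1 < p.2.2.2) :
    chainWeight T r₁ r₂ r₃ p = ENNReal.ofReal ((p.2.1 - p.1) ^ (-r₁) *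
      (p.2.2.1 - p.2.1) ^ (-r₂) * (p.2.2.2 - p.2.2.1) ^ (-r₃)) := by
  obtain ⟨⟨h1, h1'⟩, ⟨h2, h2'⟩, ⟨h3, h3'⟩, ⟨h4, h4'⟩, -⟩ := hp
  rw [chainWeight, indicator_of_mem (show p.1 ∈ Icc 0 T from ⟨h1, h1'⟩),
    powWeight_of_pos (by linarith) (by linarith), powWeight_of_pos (by linarith) (by linarith),
    powWeight_of_pos (by linarith) (by linarith), Pi.one_apply, one_mul, mul_assoc,
    ENNReal.ofReal_mul (Real.rpow_nonneg (by linarith) _),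
    ENNReal.ofReal_mul (Real.rpow_nonneg (by linarith) _)]

lemma chainWeight_eq_top {T r₁ r₂ r₃ : ℝ} (h₁ : 0 < r₁) (h₂ : 0 < r₂) (h₃ : 0 < r₃)
    {p : ℝ × ℝ × ℝ × ℝ} (hp : p ∈ regS1 T)
    (h : p.1 = p.2.1 ∨ p.2.1 = p.2.2.1 ∨ p.2.2.1 = p.2.2.2) : chainWeight T r₁ r₂ r₃ p = ⊤ := by
  obtain ⟨⟨h1, h1'⟩, ⟨h2, h2'⟩, ⟨h3, h3'⟩, ⟨h4, h4'⟩, ha, hb, hc⟩ := hp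
  have hT : 0 ≤ T := h1.trans h1'
  have n₁ := powWeight_ne_zero (T := T) h₁ (u := p.2.1 - p.1) ⟨by linarith, by linarith⟩
  have n₂ := powWeight_ne_zero (T := T) h₂ (u := p.2.2.1 - p.2.1) ⟨by linarith, by linarith⟩
  have n₃ := powWeight_ne_zero (T := T) h₃ (u := p.2.2.2 - p.2.2.1) ⟨by linarith, by linarith⟩
  rw [chainWeight, indicator_of_mem (show p.1 ∈ Icc 0 T from ⟨h1, h1'⟩), Pi.one_apply, one_mul]
  rcases h with h | h | h
  · rw [h, sub_self, powWeight_zero hT h₁, ENNReal.top_mul (mul_ne_zero n₂ n₃)]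
  · rw [h, sub_self, powWeight_zero hT h₂, ENNReal.top_mul n₃, ENNReal.mul_top]
    rwa [h] at n₁
  · rw [h, sub_self, powWeight_zero hT h₃, ENNReal.mul_top, ENNReal.mul_top n₁]
    rwa [h] at n₂

lemma measurableSet_regS1 (T : ℝ) : MeasurableSet (regS1 T) := by
  unfold regS1
  simp only [mem_Icc]
  measurability

lemma exists_abs_V1_le {T H : ℝ} (hT : 0 ≤ T) (hH : H ∈ Ioo (2 / 3 : ℝ) 1) :
    ∃ C, ∀ ε, 0 < ε → |V1 H T ε| ≤ C * ε ^ (-(9 / 4 - 3 / (2 * H))) := by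
  have hH' := hH
  obtain ⟨hH0, hH1⟩ := hH'
  set β := 3 / 2 - 3 * H / 4 with hβ
  have hβ0 : 0 < β := by linarith
  have hβ1 : β < 1 := by linarith
  have hHpos : 0 < H := by linarith
  set W : ℝ × ℝ × ℝ × ℝ → ENNReal := fun p =>
    chainWeight T H β β p + chainWeight T β H β p + chainWeight T β β H p with hW
  have hWint : ∫⁻ p, W p ≠ ⊤ := by
    rw [hW, lintegral_add_right _ (measurable_chainWeight _ _ _ _),
      lintegral_add_right _ (measurable_chainWeight _ _ _ _)]
    exact ENNReal.add_ne_top.2 ⟨ENNReal.add_ne_top.2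
      ⟨lintegral_chainWeight_ne_top hT hH1 hβ1 hβ1, lintegral_chainWeight_ne_top hT hβ1 hH1 hβ1⟩,
      lintegral_chainWeight_ne_top hT hβ1 hβ1 hH1⟩
  have hk : 0 < (1 - H) / 4 := by linarith
  refine ⟨1 / π * (4 * ((1 - H) / 4) ^ (-(3 / 2 : ℝ)) * (∫⁻ p, W p).toReal), fun ε hε => ?_⟩
  set c := 4 * ((1 - H) / 4) ^ (-(3 / 2 : ℝ)) * ε ^ (-(9 / 4 - 3 / (2 * H))) with hc
  have hc0 : 0 < c := by positivity
  set f : ℝ × ℝ × ℝ × ℝ → ℝ := fun p =>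
    ((ε + (p.2.2.1 - p.1) ^ (2*H)) * (ε + (p.2.2.2 - p.2.1) ^ (2*H)) -
        mu H (p.2.1 - p.1) (p.2.2.1 - p.1) (p.2.2.2 - p.2.1) ^ 2) ^ (-(3/2 : ℝ)) *
      mu H (p.2.1 - p.1) (p.2.2.1 - p.1) (p.2.2.2 - p.2.1) with hf
  have hpt : ∀ p ∈ regS1 T, ‖f p‖ₑ ≤ ENNReal.ofReal c * W p := by
    intro p hp
    obtain ⟨-, -, -, -, ha, hb, hd⟩ := id hp
    by_cases h : p.1 = p.2.1 ∨ p.2.1 = p.2.2.1 ∨ p.2.2.1 = p.2.2.2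
    · rw [hW]
      simp only
      rw [chainWeight_eq_top hHpos hβ0 hβ0 hp h, top_add, top_add,
        ENNReal.mul_top (by simpa using hc0)]
      exact le_top
    · push Not at h
      have ha' := lt_of_le_of_ne ha h.1
      have hb' := lt_of_le_of_ne hb h.2.1
      have hd' := lt_of_le_of_ne hd h.2.2
      have hA := sub_pos.2 ha'
      have hB := sub_pos.2 hb'
      have hD := sub_pos.2 hd'
      have hle := integrand_le hH hε hA hB hD
      rw [incrDet, sub_add_sub_cancel', sub_add_sub_cancel'] at hle
      rw [hW]
      simp only
      rw [chainWeight_of_pos hp ha' hb' hd', chainWeight_of_pos hp ha' hb' hd',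
        chainWeight_of_pos hp ha' hb' hd', ← ENNReal.ofReal_add (by positivity) (by positivity),
        ← ENNReal.ofReal_add (by positivity) (by positivity), ← ENNReal.ofReal_mul hc0.le,
        ← ofReal_norm]
      exact ENNReal.ofReal_le_ofReal hle
  have hint : ‖∫ p in regS1 T, f p‖ₑ ≤ ENNReal.ofReal c * ∫⁻ p, W p :=
    calc ‖∫ p in regS1 T, f p‖ₑ ≤ ∫⁻ p in regS1 T, ‖f p‖ₑ := enorm_integral_le_lintegral_enorm _
      _ ≤ ∫⁻ p in regS1 T, ENNReal.ofReal c * W p :=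
          setLIntegral_mono' (measurableSet_regS1 T) hpt
      _ ≤ ∫⁻ p, ENNReal.ofReal c * W p := setLIntegral_le_lintegral _ _
      _ = ENNReal.ofReal c * ∫⁻ p, W p := lintegral_const_mul' _ _ ENNReal.ofReal_ne_top
  have hreal : |∫ p in regS1 T, f p| ≤ c * (∫⁻ p, W p).toReal := by
    have h := ENNReal.toReal_mono (ENNReal.mul_ne_top ENNReal.ofReal_ne_top hWint) hint
    rwa [toReal_enorm, ENNReal.toReal_mul, ENNReal.toReal_ofReal hc0.le, Real.norm_eq_abs] at h
  calc |V1 H T ε| = 1 / π * |∫ p in regS1 T, f p| := by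
        rw [V1, abs_mul, abs_of_pos (by positivity)]
    _ ≤ 1 / π * (c * (∫⁻ p, W p).toReal) := by gcongr
    _ = _ := by rw [hc]; ring

/-- For `2/3 < H < 1`, `ε^{3 - 2/H} V₁(ε) → 0` as `ε → 0⁺`. -/
theorem tendsto_V1 (T : ℝ) (hT : 0 < T) (H : ℝ) (hH : H ∈ Ioo (2/3 : ℝ) 1) :
    Tendsto (fun ε : ℝ => ε ^ (3 - 2/H) * V1 H T ε) (nhdsWithin 0 (Ioi 0)) (nhds 0) := by
  obtain ⟨C, hC⟩ := exists_abs_V1_le hT.le hH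
  have hHpos : 0 < H := by linarith [hH.1]
  have hη : 0 < 3 / 4 - 1 / (2 * H) := by
    have : 1 / (2 * H) < 3 / 4 := by
      rw [div_lt_iff₀ (by positivity)]
      linarith [hH.1]
    linarith
  have hpow : Tendsto (fun ε : ℝ => C * ε ^ (3 / 4 - 1 / (2 * H))) (nhdsWithin 0 (Ioi 0))
      (nhds 0) := by
    have h := ((Real.continuousAt_rpow_const 0 _ (Or.inr hη.le)).tendsto.const_mul C).mono_left
      (nhdsWithin_le_nhds (s := Ioi 0))
    rwa [Real.zero_rpow hη.ne', mul_zero] at h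
  refine squeeze_zero_norm' ?_ hpow
  filter_upwards [self_mem_nhdsWithin] with ε hε
  have hε0 : 0 < ε := hε
  calc ‖ε ^ (3 - 2 / H) * V1 H T ε‖ = ε ^ (3 - 2 / H) * |V1 H T ε| := by
        rw [norm_mul, Real.norm_of_nonneg (by positivity), Real.norm_eq_abs]
    _ ≤ ε ^ (3 - 2 / H) * (C * ε ^ (-(9 / 4 - 3 / (2 * H)))) := by
        gcongr
        exact hC ε hε0
    _ = C * ε ^ (3 / 4 - 1 / (2 * H)) := by
        rw [mul_left_comm, ← Real.rpow_add hε0]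
        congr 2
        field_simp
        ring
end

section
/- Let $T>0$ and $H\in(\tfrac23,1)$. Then $\lim_{\varepsilon\to0^+}\varepsilon^{3-\frac2H}\, V_2(\varepsilon) = 0$, where $V_2(\varepsilon) := \frac1\pi\int_{\mathcal{S}_2} \big((\varepsilon+\Sigma_{11})(\varepsilon+\Sigma_{22})-\Sigma_{12}^2\big)^{-3/2}\,\Sigma_{12}\; ds_1\, ds_2\, dt_1\, dt_2$. -/
open Real Set MeasureTheory Filter

/-- The region `𝒮₂ = {(s₁,s₂,t₁,t₂) ∈ [0,T]⁴ : s₁ ≤ s₂ ≤ t₂ ≤ t₁}`. -/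
def regS2 (T : ℝ) : Set (ℝ × ℝ × ℝ × ℝ) :=
  {p | p.1 ∈ Icc (0:ℝ) T ∧ p.2.1 ∈ Icc (0:ℝ) T ∧ p.2.2.1 ∈ Icc (0:ℝ) T ∧
    p.2.2.2 ∈ Icc (0:ℝ) T ∧ p.1 ≤ p.2.1 ∧ p.2.1 ≤ p.2.2.2 ∧ p.2.2.2 ≤ p.2.2.1}

/-- `V₁(ε)`, the contribution of the region `𝒮₂` to `𝔼[α_ε²]`: the integral over `𝒮₂` of
`det(εI + Σ)^{-3/2} Σ₁₂ / π`, where `Σ` is the covariance matrix of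
`(B_{t₁}-B_{s₁}, B_{t₂}-B_{s₂})`. -/
noncomputable def V2 (H T ε : ℝ) : ℝ :=
  (1/π) * ∫ p in regS2 T,
    ((ε + (p.2.2.1 - p.1) ^ (2*H)) * (ε + (p.2.2.2 - p.2.1) ^ (2*H)) -
        mu H (p.2.1 - p.1) (p.2.2.1 - p.1) (p.2.2.2 - p.2.1) ^ 2) ^ (-(3/2 : ℝ)) *
      mu H (p.2.1 - p.1) (p.2.2.1 - p.1) (p.2.2.2 - p.2.1)

lemma rpow_add_sub_rpow_le {q x y b : ℝ} (hq0 : 0 ≤ q) (hq1 : q ≤ 1) (hx : 0 ≤ x) (hxy : x ≤ y)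
    (hb : 0 ≤ b) : (y + b) ^ q - y ^ q ≤ (x + b) ^ q - x ^ q := by
  rcases eq_or_lt_of_le (show x ≤ y + b by linarith) with h | h
  · have h1 : b = 0 := by linarith
    subst h1
    simp
  have hc := Real.concaveOn_rpow hq0 hq1
  have hd : 0 < y + b - x := by linarith
  have hx' : x ∈ Ici (0:ℝ) := hx
  have hz' : y + b ∈ Ici (0:ℝ) := by simp only [mem_Ici]; linarith
  have hw1 : 0 ≤ b / (y + b - x) := by positivity
  have hw2 : 0 ≤ (y - x) / (y + b - x) := div_nonneg (by linarith) hd.le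
  have h1 := hc.2 hx' hz' hw1 hw2 (by field_simp; ring)
  have h2 := hc.2 hx' hz' hw2 hw1 (by field_simp; ring)
  simp only [smul_eq_mul] at h1 h2
  have e1 : b / (y + b - x) * x + (y - x) / (y + b - x) * (y + b) = y := by field_simp; ring
  have e2 : (y - x) / (y + b - x) * x + b / (y + b - x) * (y + b) = x + b := by field_simp; ring
  rw [e1] at h1
  rw [e2] at h2
  have e3 : b / (y + b - x) + (y - x) / (y + b - x) = 1 := by field_simp; ring
  have e4 : (b / (y + b - x) + (y - x) / (y + b - x)) * (x ^ q + (y + b) ^ q)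
      = x ^ q + (y + b) ^ q := by rw [e3, one_mul]
  linarith

lemma two_sub_two_rpow_mul_le {q A B : ℝ} (hq0 : 0 ≤ q) (hq1 : q ≤ 1) (hB : 0 ≤ B) (hAB : B ≤ A) :
    (2 - 2 ^ q) * B ^ q ≤ A ^ q + B ^ q - (A + B) ^ q := by
  have h := rpow_add_sub_rpow_le hq0 hq1 hB hAB hB
  have e : (B + B) ^ q = 2 ^ q * B ^ q := by
    rw [← two_mul, Real.mul_rpow (by norm_num) hB]
  rw [e] at h
  linarith

lemma concaveOn_rpow_add_sub_rpow {p b : ℝ} (hp1 : 1 ≤ p) (hp2 : p ≤ 2) (hb : 0 ≤ b) :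
    ConcaveOn ℝ (Ici 0) (fun x : ℝ => (x + b) ^ p - x ^ p) := by
  have hd : ∀ x : ℝ, HasDerivAt (fun x : ℝ => (x + b) ^ p - x ^ p)
      (p * (x + b) ^ (p - 1) - p * x ^ (p - 1)) x := by
    intro x
    have h1 := ((hasDerivAt_id x).add_const b).rpow_const (p := p) (Or.inr hp1)
    have h2 := (hasDerivAt_id x).rpow_const (p := p) (Or.inr hp1)
    convert! h1.sub h2 using 1
    simp
  refine AntitoneOn.concaveOn_of_deriv (convex_Ici 0)
    (fun x _ => (hd x).continuousAt.continuousWithinAt)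
    (fun x _ => (hd x).differentiableAt.differentiableWithinAt) ?_
  intro x hx y _ hxy
  rw [interior_Ici, mem_Ioi] at hx
  rw [(hd x).deriv, (hd y).deriv, ← mul_sub, ← mul_sub]
  exact mul_le_mul_of_nonneg_left
    (rpow_add_sub_rpow_le (by linarith) (by linarith) hx.le hxy hb) (by linarith)

/-- The covariance of the increments over `[0, a + b + c]` and `[a, a + b]`. -/
lemma mu_nested (H : ℝ) {a b c : ℝ} (hb : 0 ≤ b) (hc : 0 ≤ c) :
    mu H a (a + b + c) b =
      (1/2) * (((a + b) ^ (2*H) - a ^ (2*H)) + ((c + b) ^ (2*H) - c ^ (2*H))) := by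
  have e1 : |a + b - (a + b + c)| = c := by
    rw [show a + b - (a + b + c) = -c by ring, abs_neg, abs_of_nonneg hc]
  have e2 : |a - (a + b + c)| = c + b := by
    rw [show a - (a + b + c) = -(c + b) by ring, abs_neg, abs_of_nonneg (by linarith)]
  rw [mu, e1, e2]
  ring

lemma mu_nested_nonneg {H a b c : ℝ} (hH : 0 ≤ H) (ha : 0 ≤ a) (hb : 0 ≤ b) (hc : 0 ≤ c) :
    0 ≤ mu H a (a + b + c) b := by
  rw [mu_nested H hb hc]
  have h1 : a ^ (2*H) ≤ (a + b) ^ (2*H) := Real.rpow_le_rpow ha (by linarith) (by linarith)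
  have h2 : c ^ (2*H) ≤ (c + b) ^ (2*H) := Real.rpow_le_rpow hc (by linarith) (by linarith)
  linarith

lemma rpow_add_sub_rpow_le_mul {p a b : ℝ} (hp : 1 ≤ p) (ha : 0 < a) (hb : 0 ≤ b) :
    (a + b) ^ p - a ^ p ≤ p * b * (a + b) ^ (p - 1) := by
  have hab : 0 < a + b := by linarith
  have h := one_add_mul_self_le_rpow_one_add (s := -(b / (a + b)))
    (by rw [neg_le_neg_iff, div_le_one hab]; linarith) hp
  have e : 1 + -(b / (a + b)) = a / (a + b) := by field_simp; ring
  rw [e, Real.div_rpow ha.le hab.le, le_div_iff₀ (by positivity)] at h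
  have e2 : (a + b) ^ p = (a + b) ^ (p - 1) * (a + b) := by
    rw [← Real.rpow_add_one hab.ne']; ring_nf
  have e3 : (1 + p * -(b / (a + b))) * (a + b) ^ p
      = (a + b) ^ p - p * b * (a + b) ^ (p - 1) := by
    rw [e2]; field_simp; ring
  linarith

lemma mu_nested_le {H a b c : ℝ} (hH : 1/2 ≤ H) (ha : 0 < a) (hb : 0 ≤ b) (hc : 0 < c) :
    mu H a (a + b + c) b ≤ 2 * H * b * (a + b + c) ^ (2*H - 1) := by
  rw [mu_nested H hb hc.le]
  have h1 := rpow_add_sub_rpow_le_mul (p := 2*H) (by linarith) ha hb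
  have h2 := rpow_add_sub_rpow_le_mul (p := 2*H) (by linarith) hc hb
  have h3 : (a + b) ^ (2*H - 1) ≤ (a + b + c) ^ (2*H - 1) :=
    Real.rpow_le_rpow (by linarith) (by linarith) (by linarith)
  have h4 : (c + b) ^ (2*H - 1) ≤ (a + b + c) ^ (2*H - 1) :=
    Real.rpow_le_rpow (by linarith) (by linarith) (by linarith)
  have h5 : 0 ≤ 2 * H * b := by positivity
  have h6 := mul_le_mul_of_nonneg_left h3 h5
  have h7 := mul_le_mul_of_nonneg_left h4 h5
  linarith

/-- Local nondeterminism for nested increments. -/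
lemma det_nested_ge {H a b c : ℝ} (hH : 1/2 ≤ H) (hH1 : H ≤ 1) (ha : 0 ≤ a) (hb : 0 ≤ b)
    (hc : 0 ≤ c) :
    (2 - 2 ^ H) * (b * ((a + c) / 2)) ^ (2*H) ≤
      (a + b + c) ^ (2*H) * b ^ (2*H) - mu H a (a + b + c) b ^ 2 := by
  set v := (a + c) / 2 with hv
  have hv0 : 0 ≤ v := by positivity
  have hM0 := mu_nested_nonneg (by linarith : 0 ≤ H) ha hb hc
  have hM : mu H a (a + b + c) b ≤ (v + b) ^ (2*H) - v ^ (2*H) := by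
    rw [mu_nested H hb hc]
    have h := (concaveOn_rpow_add_sub_rpow (p := 2*H) (b := b) (by linarith) (by linarith) hb).2
      (mem_Ici.2 ha) (mem_Ici.2 hc) (show (0:ℝ) ≤ 1/2 by norm_num)
      (show (0:ℝ) ≤ 1/2 by norm_num) (by norm_num)
    simp only [smul_eq_mul] at h
    rw [show 1/2 * a + 1/2 * c = v by rw [hv]; ring] at h
    linarith
  set M := mu H a (a + b + c) b
  set A := b * (a + b + c) with hA
  set B := v ^ 2 with hB
  have hA0 : 0 ≤ A := by positivity
  have hB0 : 0 ≤ B := by positivity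
  have sq : ∀ x : ℝ, 0 ≤ x → x ^ (2*H) = (x ^ 2) ^ H := by
    intro x hx
    rw [Real.rpow_mul hx, Real.rpow_two]
  have e1 : (v + b) ^ (2*H) = (A + B) ^ H := by
    rw [sq _ (by positivity), hA, hB, hv]; congr 1; ring
  have e2 : v ^ (2*H) = B ^ H := sq v hv0
  have e3 : (a + b + c) ^ (2*H) * b ^ (2*H) = (A ^ H) ^ 2 := by
    rw [← Real.mul_rpow (by positivity) hb, sq _ (by positivity), ← Real.rpow_natCast (A ^ H),
      ← Real.rpow_mul hA0, mul_comm H, Real.rpow_mul hA0, Real.rpow_natCast, hA,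
      mul_comm b]
  have e4 : (b * v) ^ (2*H) = ((b * v) ^ 2) ^ H := sq _ (by positivity)
  have hc0 : 0 ≤ 2 - (2:ℝ) ^ H := by
    have : (2:ℝ) ^ H ≤ 2 ^ (1:ℝ) := Real.rpow_le_rpow_of_exponent_le (by norm_num) hH1
    rw [Real.rpow_one] at this
    linarith
  have hW : 0 ≤ A ^ H := by positivity
  have key : (2 - 2 ^ H) * min A B ^ H ≤ A ^ H - M := by
    rcases le_total A B with h | h
    · rw [min_eq_left h]
      have := two_sub_two_rpow_mul_le (by linarith : 0 ≤ H) hH1 hA0 h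
      rw [add_comm B A] at this
      rw [e1, e2] at hM
      linarith
    · rw [min_eq_right h]
      have := two_sub_two_rpow_mul_le (by linarith : 0 ≤ H) hH1 hB0 h
      rw [e1, e2] at hM
      linarith
  have hmin : (b * v) ^ 2 ≤ min A B * A := by
    have hbA : b ^ 2 ≤ A := by
      rw [hA]; nlinarith [mul_nonneg hb ha, mul_nonneg hb hc]
    have hbv : b * v ≤ A := by
      rw [hA, hv]; nlinarith [mul_nonneg hb ha, mul_nonneg hb hc]
    rcases le_total A B with h | h
    · rw [min_eq_left h, ← pow_two]
      exact pow_le_pow_left₀ (by positivity) hbv 2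
    · rw [min_eq_right h, hB, mul_pow, mul_comm]
      exact mul_le_mul_of_nonneg_left hbA (by positivity)
  have hpow : (b * v) ^ (2*H) ≤ min A B ^ H * A ^ H := by
    rw [e4, ← Real.mul_rpow (le_min hA0 hB0) hA0]
    exact Real.rpow_le_rpow (by positivity) hmin (by linarith)
  rw [e3]
  calc (2 - 2 ^ H) * (b * v) ^ (2*H) ≤ (2 - 2 ^ H) * (min A B ^ H * A ^ H) :=
        mul_le_mul_of_nonneg_left hpow hc0
    _ = ((2 - 2 ^ H) * min A B ^ H) * A ^ H := by ring
    _ ≤ (A ^ H - M) * A ^ H := mul_le_mul_of_nonneg_right key hW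
    _ ≤ (A ^ H) ^ 2 - M ^ 2 := by
        have h0 : 0 ≤ A ^ H - M := le_trans (mul_nonneg hc0 (by positivity)) key
        nlinarith [mul_nonneg h0 hM0]

lemma rpow_neg_three_halves_le {H q κ ε m M D : ℝ} (hH : 0 < H) (hq : 0 ≤ q) (hqH : q ≤ 3 * H)
    (hκ : 0 < κ) (hε : 0 < ε) (hm : 0 < m) (hM : 0 < M)
    (h1 : κ * (ε * M ^ (2*H)) ≤ D) (h2 : κ * (m ^ (2*H) * M ^ (2*H)) ≤ D) :
    D ^ (-(3/2 : ℝ)) ≤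
      κ ^ (-(3/2 : ℝ)) * (ε ^ (-(3/2 - q / (2*H))) * (m ^ (-q) * M ^ (-(3*H)))) := by
  have hD : 0 < D := lt_of_lt_of_le (by positivity) h1
  set j := q / (2*H) with hj
  have hjq : 2 * H * j = q := by rw [hj]; field_simp
  have hj0 : 0 ≤ j := by positivity
  have hj1 : j ≤ 3/2 := by rw [hj, div_le_iff₀ (by positivity)]; linarith
  have b1 : D ^ (-(3/2 - j)) ≤ (κ * (ε * M ^ (2*H))) ^ (-(3/2 - j)) :=
    Real.rpow_le_rpow_of_nonpos (by positivity) h1 (by linarith)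
  have b2 : D ^ (-j) ≤ (κ * (m ^ (2*H) * M ^ (2*H))) ^ (-j) :=
    Real.rpow_le_rpow_of_nonpos (by positivity) h2 (by linarith)
  calc D ^ (-(3/2 : ℝ)) = D ^ (-(3/2 - j)) * D ^ (-j) := by
        rw [← Real.rpow_add hD]; congr 1; ring
    _ ≤ (κ * (ε * M ^ (2*H))) ^ (-(3/2 - j)) * (κ * (m ^ (2*H) * M ^ (2*H))) ^ (-j) := by
        gcongr
    _ = (κ ^ (-(3/2 - j)) * κ ^ (-j)) * (ε ^ (-(3/2 - j)) *
          ((m ^ (2*H)) ^ (-j) * ((M ^ (2*H)) ^ (-(3/2 - j)) * (M ^ (2*H)) ^ (-j)))) := by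
        rw [Real.mul_rpow hκ.le (by positivity), Real.mul_rpow hε.le (by positivity),
          Real.mul_rpow hκ.le (by positivity), Real.mul_rpow (by positivity) (by positivity)]
        ring
    _ = _ := by
        rw [← Real.rpow_add hκ, ← Real.rpow_add (by positivity), ← Real.rpow_mul hm.le,
          ← Real.rpow_mul hM.le]
        congr 2
        · ring
        · congr 3
          · rw [← hjq]; ring
          · ring

lemma add_rpow_neg_two_mul_le {a c γ : ℝ} (ha : 0 < a) (hc : 0 < c) (hγ : 0 ≤ γ) :
    (a + c) ^ (-(2*γ)) ≤ a ^ (-γ) * c ^ (-γ) := by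
  rw [← Real.mul_rpow ha.le hc.le, show -(2*γ) = 2 * -γ by ring, Real.rpow_mul (by positivity),
    Real.rpow_two]
  exact Real.rpow_le_rpow_of_nonpos (by positivity) (by nlinarith [mul_pos ha hc]) (by linarith)

lemma exists_integrand_le {H q : ℝ} (hH : 2/3 < H) (hH1 : H < 1) (hq : 0 ≤ q) (hqH : q ≤ 3 * H) :
    ∃ C : ℝ, 0 ≤ C ∧ ∀ ε a b c : ℝ, 0 < ε → 0 < a → 0 < b → 0 < c →
      |((ε + (a + b + c) ^ (2*H)) * (ε + b ^ (2*H)) - mu H a (a + b + c) b ^ 2) ^ (-(3/2 : ℝ)) *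
          mu H a (a + b + c) b| ≤
        C * ε ^ (-(3/2 - q / (2*H))) *
          (b ^ (1 - q) * (a ^ (-((H + 1) / 2)) * c ^ (-((H + 1) / 2))) +
            b ^ (-H) * (a ^ (-(q / 2)) * c ^ (-(q / 2)))) := by
  set κ := (2 - (2:ℝ) ^ H) * (1/2) ^ (2*H) with hκ
  have hc0 : 0 < 2 - (2:ℝ) ^ H := by
    have : (2:ℝ) ^ H < 2 ^ (1:ℝ) := Real.rpow_lt_rpow_of_exponent_lt (by norm_num) hH1
    rw [Real.rpow_one] at this
    linarith
  have hκ0 : 0 < κ := by positivity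
  have hκ1 : κ ≤ 1 := by
    have h1 : (1:ℝ) ≤ 2 ^ H := Real.one_le_rpow (by norm_num) (by linarith)
    have h2 : ((1:ℝ)/2) ^ (2*H) ≤ 1 :=
      Real.rpow_le_one (by norm_num) (by norm_num) (by linarith)
    rw [hκ]
    exact mul_le_one₀ (by linarith) (by positivity) h2
  refine ⟨κ ^ (-(3/2 : ℝ)) * (2 * H * 2 ^ (2*H - 1)), by positivity, ?_⟩
  intro ε a b c hε ha hb hc
  have hμ0 := mu_nested_nonneg (by linarith : 0 ≤ H) ha.le hb.le hc.le
  have hμ := mu_nested_le (by linarith : 1/2 ≤ H) ha hb.le hc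
  have hdet := det_nested_ge (by linarith : 1/2 ≤ H) hH1.le ha.le hb.le hc.le
  set u := a + b + c with hu
  set μ := mu H a u b
  set r := a + c with hr
  set D := (ε + u ^ (2*H)) * (ε + b ^ (2*H)) - μ ^ 2 with hD
  have hu0 : 0 < u := by positivity
  have hr0 : 0 < r := by positivity
  have hdet' : κ * (b ^ (2*H) * r ^ (2*H)) ≤ u ^ (2*H) * b ^ (2*H) - μ ^ 2 := by
    refine le_trans (le_of_eq ?_) hdet
    rw [show b * (r / 2) = (1/2) * (b * r) by ring, Real.mul_rpow (by norm_num) (by positivity),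
      Real.mul_rpow hb.le hr0.le, hκ]
    ring
  have hub : 0 ≤ u ^ (2*H) := by positivity
  have hbb : 0 ≤ b ^ (2*H) := by positivity
  have hDdet : u ^ (2*H) * b ^ (2*H) - μ ^ 2 ≤ D := by
    rw [hD]; nlinarith [mul_nonneg hε.le hub, mul_nonneg hε.le hbb]
  have hDu : ε * u ^ (2*H) ≤ D := by
    have : 0 ≤ κ * (b ^ (2*H) * r ^ (2*H)) := by positivity
    rw [hD]; nlinarith [mul_nonneg hε.le hub, mul_nonneg hε.le hbb]
  have hDM : ∀ M, 0 < M → M ≤ u → κ * (ε * M ^ (2*H)) ≤ D := by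
    intro M hM hMu
    have h1 : M ^ (2*H) ≤ u ^ (2*H) := Real.rpow_le_rpow hM.le hMu (by linarith)
    calc κ * (ε * M ^ (2*H)) ≤ 1 * (ε * u ^ (2*H)) := by gcongr
      _ ≤ D := by rw [one_mul]; exact hDu
  have hD0 : 0 < D := lt_of_lt_of_le (by positivity) hDu
  have hμM : ∀ M, 0 < M → u ≤ 2 * M → μ ≤ 2 * H * 2 ^ (2*H - 1) * (b * M ^ (2*H - 1)) := by
    intro M hM hMu
    have h1 : u ^ (2*H - 1) ≤ (2 * M) ^ (2*H - 1) :=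
      Real.rpow_le_rpow hu0.le hMu (by linarith)
    rw [Real.mul_rpow (by norm_num) hM.le] at h1
    calc μ ≤ 2 * H * b * u ^ (2*H - 1) := hμ
      _ ≤ 2 * H * b * (2 ^ (2*H - 1) * M ^ (2*H - 1)) := by gcongr
      _ = _ := by ring
  rw [abs_of_nonneg (by positivity)]
  have hE : 0 < ε ^ (-(3/2 - q / (2*H))) := by positivity
  rcases le_total b r with h | h
  · have h1 := rpow_neg_three_halves_le (by linarith) hq hqH hκ0 hε hb hr0
      (hDM r hr0 (by linarith)) (hdet'.trans hDdet)
    have h2 := hμM r hr0 (by linarith)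
    have h3 : b ^ (-q) * b = b ^ (1 - q) := by
      rw [← Real.rpow_add_one hb.ne']; congr 1; ring
    have h4 : r ^ (-(3*H)) * r ^ (2*H - 1) = r ^ (-(2 * ((H + 1) / 2))) := by
      rw [← Real.rpow_add hr0]; congr 1; ring
    have h5 := add_rpow_neg_two_mul_le ha hc (by linarith : 0 ≤ (H + 1) / 2)
    calc D ^ (-(3/2 : ℝ)) * μ ≤
        (κ ^ (-(3/2 : ℝ)) * (ε ^ (-(3/2 - q / (2*H))) * (b ^ (-q) * r ^ (-(3*H))))) *
          (2 * H * 2 ^ (2*H - 1) * (b * r ^ (2*H - 1))) := by gcongr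
      _ = κ ^ (-(3/2 : ℝ)) * (2 * H * 2 ^ (2*H - 1)) * ε ^ (-(3/2 - q / (2*H))) *
          (b ^ (1 - q) * r ^ (-(2 * ((H + 1) / 2)))) := by rw [← h3, ← h4]; ring
      _ ≤ _ := by
        gcongr
        exact le_trans (by gcongr) (le_add_of_nonneg_right (by positivity))
  · have h1 := rpow_neg_three_halves_le (by linarith) hq hqH hκ0 hε hr0 hb
      (hDM b hb (by linarith)) (by rw [mul_comm (r ^ _)]; exact hdet'.trans hDdet)
    have h2 := hμM b hb (by linarith)
    have h3 : b ^ (-(3*H)) * (b * b ^ (2*H - 1)) = b ^ (-H) := by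
      rw [mul_comm b, ← Real.rpow_add_one hb.ne', ← Real.rpow_add hb]; congr 1; ring
    have h5 := add_rpow_neg_two_mul_le ha hc (by linarith : 0 ≤ q / 2)
    rw [show 2 * (q / 2) = q by ring] at h5
    calc D ^ (-(3/2 : ℝ)) * μ ≤
        (κ ^ (-(3/2 : ℝ)) * (ε ^ (-(3/2 - q / (2*H))) * (r ^ (-q) * b ^ (-(3*H))))) *
          (2 * H * 2 ^ (2*H - 1) * (b * b ^ (2*H - 1))) := by gcongr
      _ = κ ^ (-(3/2 : ℝ)) * (2 * H * 2 ^ (2*H - 1)) * ε ^ (-(3/2 - q / (2*H))) *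
          (b ^ (-H) * r ^ (-q)) := by rw [← h3]; ring
      _ ≤ _ := by
        gcongr
        exact le_trans (by gcongr) (le_add_of_nonneg_left (by positivity))

/-- The lengths of the three gaps in `s₁ ≤ s₂ ≤ t₂ ≤ t₁` are measure-preserving coordinates. -/
lemma measurePreserving_gaps :
    MeasurePreserving (fun p : ℝ × ℝ × ℝ × ℝ =>
      (p.1, p.2.1 - p.1, p.2.2.1 - p.2.2.2, p.2.2.2 - p.2.1)) := by
  have m2 : ∀ s : ℝ, MeasurePreserving (fun p : ℝ × ℝ => (p.1 - p.2, p.2 - s)) := fun s =>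
    ((MeasurePreserving.id volume).prod (measurePreserving_sub_right volume s)).comp
      (measurePreserving_sub_prod (volume : Measure ℝ) volume)
  have m3 : ∀ s : ℝ, MeasurePreserving
      (fun p : ℝ × ℝ × ℝ => (p.1 - s, p.2.1 - p.2.2, p.2.2 - p.1)) := fun s =>
    (measurePreserving_sub_right volume s).skew_product
      (g := fun x (p : ℝ × ℝ) => (p.1 - p.2, p.2 - x))
      (by unfold Function.uncurry; fun_prop) (Eventually.of_forall fun x => (m2 x).map_eq)
  exact (MeasurePreserving.id volume).skew_product
    (g := fun x (p : ℝ × ℝ × ℝ) => (p.1 - x, p.2.1 - p.2.2, p.2.2 - p.1))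
    (by unfold Function.uncurry; fun_prop) (Eventually.of_forall fun x => (m3 x).map_eq)

lemma integrable_indicator_rpow {T β : ℝ} (hT : 0 ≤ T) (hβ : -1 < β) :
    Integrable ((Ioc 0 T).indicator fun x : ℝ => x ^ β) := by
  rw [integrable_indicator_iff measurableSet_Ioc,
    ← intervalIntegrable_iff_integrableOn_Ioc_of_le hT]
  exact intervalIntegral.intervalIntegrable_rpow' hβ

lemma integrable_gaps {T β γ : ℝ} (hT : 0 ≤ T) (hβ : -1 < β) (hγ : -1 < γ) :
    Integrable (fun p : ℝ × ℝ × ℝ × ℝ =>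
      (Icc 0 T).indicator (fun _ => (1 : ℝ)) p.1 *
        ((Ioc 0 T).indicator (fun x => x ^ γ) (p.2.1 - p.1) *
          ((Ioc 0 T).indicator (fun x => x ^ γ) (p.2.2.1 - p.2.2.2) *
            (Ioc 0 T).indicator (fun x => x ^ β) (p.2.2.2 - p.2.1)))) := by
  have h1 : Integrable ((Icc 0 T).indicator fun _ : ℝ => (1 : ℝ)) := by
    rw [integrable_indicator_iff measurableSet_Icc]
    exact integrableOn_const (by simp)
  have h := h1.mul_prod ((integrable_indicator_rpow hT hγ).mul_prod
    ((integrable_indicator_rpow hT hγ).mul_prod (integrable_indicator_rpow hT hβ)))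
  exact (measurePreserving_gaps.integrable_comp h.aestronglyMeasurable).2 h

lemma ae_gaps_ne_zero :
    ∀ᵐ p : ℝ × ℝ × ℝ × ℝ, p.2.1 - p.1 ≠ 0 ∧ p.2.2.1 - p.2.2.2 ≠ 0 ∧ p.2.2.2 - p.2.1 ≠ 0 := by
  have h0 : ∀ᵐ x : ℝ, x ≠ 0 := Measure.ae_ne volume 0
  refine measurePreserving_gaps.quasiMeasurePreserving.ae
    (p := fun y : ℝ × ℝ × ℝ × ℝ => y.2.1 ≠ 0 ∧ y.2.2.1 ≠ 0 ∧ y.2.2.2 ≠ 0) ?_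
  have q2 : Measure.QuasiMeasurePreserving (fun y : ℝ × ℝ × ℝ × ℝ => y.2) :=
    Measure.quasiMeasurePreserving_snd
  have q3 : Measure.QuasiMeasurePreserving (fun y : ℝ × ℝ × ℝ => y.2) :=
    Measure.quasiMeasurePreserving_snd
  have f3 : Measure.QuasiMeasurePreserving (fun y : ℝ × ℝ × ℝ => y.1) :=
    Measure.quasiMeasurePreserving_fst
  have s2 : Measure.QuasiMeasurePreserving (fun y : ℝ × ℝ => y.2) :=
    Measure.quasiMeasurePreserving_snd
  have f2 : Measure.QuasiMeasurePreserving (fun y : ℝ × ℝ => y.1) :=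
    Measure.quasiMeasurePreserving_fst
  filter_upwards [(f3.comp q2).ae h0, ((f2.comp q3).comp q2).ae h0,
    ((s2.comp q3).comp q2).ae h0] with y h1 h2 h3
  exact ⟨h1, h2, h3⟩

lemma measurableSet_regS2 (T : ℝ) : MeasurableSet (regS2 T) := by
  apply IsClosed.measurableSet
  simp only [regS2, mem_Icc, ofPred_and]
  repeat' apply IsClosed.inter
  all_goals exact isClosed_le (by fun_prop) (by fun_prop)

lemma exists_abs_V2_le {T H q : ℝ} (hT : 0 < T) (hH : 2/3 < H) (hH1 : H < 1) (hq : 0 ≤ q)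
    (hq2 : q < 2) (hqH : q ≤ 3 * H) :
    ∃ K : ℝ, ∀ ε : ℝ, 0 < ε → |V2 H T ε| ≤ K * ε ^ (-(3/2 - q / (2*H))) := by
  obtain ⟨C, hC, hb⟩ := exists_integrand_le hH hH1 hq hqH
  set G : ℝ → ℝ → ℝ × ℝ × ℝ × ℝ → ℝ := fun β γ p =>
    (Icc 0 T).indicator (fun _ => (1 : ℝ)) p.1 *
        ((Ioc 0 T).indicator (fun x => x ^ γ) (p.2.1 - p.1) *
          ((Ioc 0 T).indicator (fun x => x ^ γ) (p.2.2.1 - p.2.2.2) *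
            (Ioc 0 T).indicator (fun x => x ^ β) (p.2.2.2 - p.2.1))) with hG
  have hG1 : Integrable (G (1 - q) (-((H + 1) / 2))) :=
    integrable_gaps hT.le (by linarith) (by linarith)
  have hG2 : Integrable (G (-H) (-(q / 2))) :=
    integrable_gaps hT.le (by linarith) (by linarith)
  have hGi := (hG1.add hG2).integrableOn (s := regS2 T)
  refine ⟨1 / π * (C * ∫ p in regS2 T, (G (1 - q) (-((H + 1) / 2)) + G (-H) (-(q / 2))) p), ?_⟩
  intro ε hε
  set E := ε ^ (-(3/2 - q / (2*H))) with hE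
  rw [V2, abs_mul, abs_of_nonneg (by positivity : 0 ≤ 1 / π), mul_assoc]
  refine mul_le_mul_of_nonneg_left ?_ (by positivity)
  rw [mul_right_comm, ← integral_const_mul, ← Real.norm_eq_abs]
  refine norm_integral_le_of_norm_le (hGi.const_mul (C * E)) ?_
  filter_upwards [ae_restrict_of_ae ae_gaps_ne_zero,
    ae_restrict_mem (measurableSet_regS2 T)] with p hp hpS
  obtain ⟨s₁, s₂, t₁, t₂⟩ := p
  simp only [regS2, mem_ofPred_eq, mem_Icc] at hp hpS
  obtain ⟨⟨h1, h2⟩, ⟨h3, h4⟩, ⟨h5, h6⟩, ⟨h7, h8⟩, h9, h10, h11⟩ := hpS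
  have ha : 0 < s₂ - s₁ := lt_of_le_of_ne (by linarith) hp.1.symm
  have hc : 0 < t₁ - t₂ := lt_of_le_of_ne (by linarith) hp.2.1.symm
  have hb' : 0 < t₂ - s₂ := lt_of_le_of_ne (by linarith) hp.2.2.symm
  have key := hb ε (s₂ - s₁) (t₂ - s₂) (t₁ - t₂) hε ha hb' hc
  rw [show s₂ - s₁ + (t₂ - s₂) + (t₁ - t₂) = t₁ - s₁ by ring] at key
  rw [Real.norm_eq_abs]
  refine key.trans (le_of_eq ?_)
  simp only [Pi.add_apply, hG]
  rw [indicator_of_mem (show s₁ ∈ Icc 0 T from ⟨h1, h2⟩),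
    indicator_of_mem (show s₂ - s₁ ∈ Ioc 0 T from ⟨ha, by linarith⟩),
    indicator_of_mem (show t₁ - t₂ ∈ Ioc 0 T from ⟨hc, by linarith⟩),
    indicator_of_mem (show t₂ - s₂ ∈ Ioc 0 T from ⟨hb', by linarith⟩),
    indicator_of_mem (show s₂ - s₁ ∈ Ioc 0 T from ⟨ha, by linarith⟩),
    indicator_of_mem (show t₁ - t₂ ∈ Ioc 0 T from ⟨hc, by linarith⟩),
    indicator_of_mem (show t₂ - s₂ ∈ Ioc 0 T from ⟨hb', by linarith⟩)]
  ring

/-- For `2/3 < H < 1`, `ε^{3 - 2/H} V₁(ε) → 0` as `ε → 0⁺`. -/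
theorem tendsto_V2 (T : ℝ) (hT : 0 < T) (H : ℝ) (hH : H ∈ Ioo (2/3 : ℝ) 1) :
    Tendsto (fun ε : ℝ => ε ^ (3 - 2/H) * V2 H T ε) (nhdsWithin 0 (Ioi 0)) (nhds 0) := by
  obtain ⟨h1, h2⟩ := hH
  obtain ⟨K, hK⟩ := exists_abs_V2_le (q := 3 - 3 * H / 2) hT h1 h2 (by linarith) (by linarith)
    (by linarith)
  have hδ : 0 < 3/4 - 1 / (2*H) := by
    rw [sub_pos, div_lt_iff₀ (by linarith)]; linarith
  have hlim : Tendsto (fun ε : ℝ => K * ε ^ (3/4 - 1 / (2*H)))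
      (nhdsWithin 0 (Ioi 0)) (nhds 0) := by
    have h := (Real.continuousAt_rpow_const 0 (3/4 - 1 / (2*H)) (Or.inr hδ.le)).tendsto.const_mul K
    rw [Real.zero_rpow hδ.ne', mul_zero] at h
    exact h.mono_left nhdsWithin_le_nhds
  refine squeeze_zero_norm' ?_ hlim
  filter_upwards [self_mem_nhdsWithin] with ε (hε : 0 < ε)
  rw [Real.norm_eq_abs, abs_mul, abs_of_pos (by positivity)]
  calc ε ^ (3 - 2/H) * |V2 H T ε|
      ≤ ε ^ (3 - 2/H) * (K * ε ^ (-(3/2 - (3 - 3 * H / 2) / (2*H)))) := by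
        gcongr
        exact hK ε hε
    _ = K * (ε ^ (3 - 2/H) * ε ^ (-(3/2 - (3 - 3 * H / 2) / (2*H)))) := by ring
    _ = K * ε ^ (3/4 - 1 / (2*H)) := by
        rw [← Real.rpow_add hε]
        congr 2
        have : H ≠ 0 := by linarith
        field_simp
        ring
end

section
/- Let $T>0$ and $H\in(\tfrac23,1)$. Then $\lim_{\varepsilon\to0^+}\varepsilon^{3-\frac2H}\, V_3(\varepsilon) = \sigma^2$, where $V_3(\varepsilon) := \frac1\pi\int_{\mathcal{S}_3} \big((\varepsilon+\Sigma_{11})(\varepsilon+\Sigma_{22})-\Sigma_{12}^2\big)^{-3/2}\,\Sigma_{12}\; ds_1\, ds_2\, dt_1\, dt_2$ and $\sigma^2 := \frac{T^{2H}(2H-1)}{4H\pi}\, B\big(\tfrac1H,\tfrac{3H-2}{2H}\big)^2\, B(2,2H-1)$, with $B(\cdot,\cdot)$ the Beta function. -/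
open Real Set MeasureTheory Filter

/-- The Euler Beta function `B(p,q) = ∫₀¹ x^{p-1}(1-x)^{q-1} dx`. -/
noncomputable def betaFn (p q : ℝ) : ℝ := ∫ x in (0:ℝ)..1, x ^ (p - 1) * (1 - x) ^ (q - 1)

/-- The region `𝒮₃ = {(s₁,s₂,t₁,t₂) ∈ [0,T]⁴ : s₁ ≤ t₁ ≤ s₂ ≤ t₂}`. -/
def regS3 (T : ℝ) : Set (ℝ × ℝ × ℝ × ℝ) :=
  {p | p.1 ∈ Icc (0:ℝ) T ∧ p.2.1 ∈ Icc (0:ℝ) T ∧ p.2.2.1 ∈ Icc (0:ℝ) T ∧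
    p.2.2.2 ∈ Icc (0:ℝ) T ∧ p.1 ≤ p.2.2.1 ∧ p.2.2.1 ≤ p.2.1 ∧ p.2.1 ≤ p.2.2.2}

/-- `V₃(ε)`, the contribution of the region `𝒮₃` to `𝔼[α_ε²]`: the integral over `𝒮₃` of
`det(εI + Σ)^{-3/2} Σ₁₂ / π`, where `Σ` is the covariance matrix of
`(B_{t₁}-B_{s₁}, B_{t₂}-B_{s₂})`. -/
noncomputable def V3 (H T ε : ℝ) : ℝ :=
  (1/π) * ∫ p in regS3 T,
    ((ε + (p.2.2.1 - p.1) ^ (2*H)) * (ε + (p.2.2.2 - p.2.1) ^ (2*H)) -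
        mu H (p.2.1 - p.1) (p.2.2.1 - p.1) (p.2.2.2 - p.2.1) ^ 2) ^ (-(3/2 : ℝ)) *
      mu H (p.2.1 - p.1) (p.2.2.1 - p.1) (p.2.2.2 - p.2.1)

lemma mu_add_self {H a b c : ℝ} (hb : 0 ≤ b) (hc : 0 ≤ c) :
    mu H (a + c) a b =
      (1/2) * ((a + b + c) ^ (2*H) - (a + c) ^ (2*H) - (b + c) ^ (2*H) + c ^ (2*H)) := by
  unfold mu
  rw [show a + c + b - a = b + c by ring, show a + c - a = c by ring,
    abs_of_nonneg (add_nonneg hb hc), abs_of_nonneg hc, show a + c + b = a + b + c by ring]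

/-- Cauchy's mean value theorem in both variables, comparing the covariance of two increments
separated by a gap `c` with `a ^ p * b ^ p`. -/
lemma exists_mu_mul_eq (H : ℝ) {p a b c : ℝ} (hp : 0 < p) (ha : 0 < a) (hb : 0 < b)
    (hc : 0 < c) :
    ∃ x ∈ Ioo 0 a, ∃ y ∈ Ioo 0 b, mu H (a + c) a b * (p * x ^ (p - 1)) * (p * y ^ (p - 1)) =
      a ^ p * b ^ p * (H * (2*H - 1) * (c + x + y) ^ (2*H - 2)) := by
  have hpow : ∀ x : ℝ, 0 < x → HasDerivAt (fun x : ℝ => x ^ p) (p * x ^ (p - 1)) x :=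
    fun x hx => Real.hasDerivAt_rpow_const (Or.inl hx.ne')
  have hshift : ∀ q d x : ℝ, 0 < x + d →
      HasDerivAt (fun x : ℝ => (x + d) ^ q) (q * (x + d) ^ (q - 1)) x := fun q d x hx => by
    simpa using ((hasDerivAt_id x).add_const d).rpow_const (p := q) (Or.inl hx.ne')
  have hcont : ∀ e : ℝ, ContinuousOn (fun x : ℝ => x ^ p) (Icc 0 e) :=
    fun e => (Real.continuous_rpow_const hp.le).continuousOn
  obtain ⟨x, hx, hx'⟩ := exists_ratio_hasDerivAt_eq_ratio_slope
    (fun x => (x + (b + c)) ^ (2*H) - (x + c) ^ (2*H))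
    (fun x => 2*H * (x + (b + c)) ^ (2*H - 1) - 2*H * (x + c) ^ (2*H - 1)) ha
    (fun x hx => ((hshift _ _ x (by linarith [hx.1])).sub
      (hshift _ _ x (by linarith [hx.1]))).continuousAt.continuousWithinAt)
    (fun x hx => (hshift _ _ x (by linarith [hx.1])).sub (hshift _ _ x (by linarith [hx.1])))
    (fun x => x ^ p) (fun x => p * x ^ (p - 1)) (hcont a) (fun x hx => hpow x hx.1)
  obtain ⟨y, hy, hy'⟩ := exists_ratio_hasDerivAt_eq_ratio_slope
    (fun y => (y + (x + c)) ^ (2*H - 1)) (fun y => (2*H - 1) * (y + (x + c)) ^ (2*H - 1 - 1)) hb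
    (fun y hy => (hshift _ _ y (by linarith [hy.1, hx.1])).continuousAt.continuousWithinAt)
    (fun y hy => hshift _ _ y (by linarith [hy.1, hx.1]))
    (fun y => y ^ p) (fun y => p * y ^ (p - 1)) (hcont b) (fun y hy => hpow y hy.1)
  refine ⟨x, hx, y, hy, ?_⟩
  rw [mu_add_self hb.le hc.le]
  simp only [Real.zero_rpow hp.ne', sub_zero, zero_add] at hx' hy'
  rw [show b + (x + c) = x + (b + c) by ring, show y + (x + c) = c + x + y by ring,
    show 2*H - 1 - 1 = 2*H - 2 by ring] at hy'
  rw [show a + (b + c) = a + b + c by ring] at hx'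
  linear_combination (-(1/2) * (p * y ^ (p - 1))) * hx' - H * a ^ p * hy'

lemma exists_mu_eq (H : ℝ) {a b c : ℝ} (ha : 0 < a) (hb : 0 < b) (hc : 0 < c) :
    ∃ z ∈ Ioo c (c + a + b), mu H (a + c) a b = a * b * (H * (2*H - 1) * z ^ (2*H - 2)) := by
  obtain ⟨x, hx, y, hy, h⟩ := exists_mu_mul_eq H one_pos ha hb hc
  refine ⟨c + x + y, ⟨by linarith [hx.1, hy.1], by linarith [hx.2, hy.2]⟩, by simpa using h⟩

lemma mu_le_mul_rpow {H a b c : ℝ} (hH : H ∈ Ioo (1/2 : ℝ) 1) (ha : 0 < a) (hb : 0 < b)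
    (hc : 0 < c) : mu H (a + c) a b ≤ (2 - 1/H) * (a ^ H * b ^ H) := by
  have hH0 : 0 < H := by linarith [hH.1]
  obtain ⟨x, ⟨hx, -⟩, y, ⟨hy, -⟩, h⟩ := exists_mu_mul_eq H hH0 ha hb hc
  have hxy : (c + x + y) ^ (2*H - 2) ≤ x ^ (H - 1) * y ^ (H - 1) := by
    rw [show 2*H - 2 = 2 * (H - 1) by ring, Real.rpow_mul (by positivity), Real.rpow_two,
      ← Real.mul_rpow hx.le hy.le]
    exact Real.rpow_le_rpow_of_nonpos (by positivity)
      (by nlinarith [mul_pos hx hy, mul_pos hc hx, mul_pos hc hy]) (by linarith [hH.2])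
  have hpos : 0 < H ^ 2 * (x ^ (H - 1) * y ^ (H - 1)) := by positivity
  refine le_of_mul_le_mul_right ?_ hpos
  have : a ^ H * b ^ H * (H * (2*H - 1)) * (c + x + y) ^ (2*H - 2) ≤
      a ^ H * b ^ H * (H * (2*H - 1)) * (x ^ (H - 1) * y ^ (H - 1)) :=
    mul_le_mul_of_nonneg_left hxy
      (mul_nonneg (by positivity) (mul_nonneg hH0.le (by linarith [hH.1])))
  calc _ = a ^ H * b ^ H * (H * (2*H - 1)) * (c + x + y) ^ (2*H - 2) := by
        linear_combination h
    _ ≤ _ := this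
    _ = _ := by field_simp

lemma mu_nonneg {H a b c : ℝ} (hH : 1/2 ≤ H) (ha : 0 < a) (hb : 0 < b) (hc : 0 < c) :
    0 ≤ mu H (a + c) a b := by
  obtain ⟨z, hz, h⟩ := exists_mu_eq H ha hb hc
  have hz0 : 0 < z := hc.trans hz.1
  rw [h]
  exact mul_nonneg (by positivity)
    (mul_nonneg (mul_nonneg (by linarith) (by linarith)) (by positivity))

lemma mu_le_mul_gap {H a b c : ℝ} (hH : H ∈ Ioo (1/2 : ℝ) 1) (ha : 0 < a) (hb : 0 < b)
    (hc : 0 < c) : mu H (a + c) a b ≤ a * b * (H * (2*H - 1) * c ^ (2*H - 2)) := by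
  obtain ⟨z, hz, h⟩ := exists_mu_eq H ha hb hc
  rw [h]
  have : 0 ≤ H * (2*H - 1) := mul_nonneg (by linarith [hH.1]) (by linarith [hH.1])
  have := Real.rpow_le_rpow_of_nonpos hc hz.1.le (by linarith [hH.2] : 2*H - 2 ≤ 0)
  gcongr

lemma le_mu_mul_gap {H a b c : ℝ} (hH : H ∈ Ioo (1/2 : ℝ) 1) (ha : 0 < a) (hb : 0 < b)
    (hc : 0 < c) :
    a * b * (H * (2*H - 1) * (c + a + b) ^ (2*H - 2)) ≤ mu H (a + c) a b := by
  obtain ⟨z, hz, h⟩ := exists_mu_eq H ha hb hc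
  rw [h]
  have : 0 ≤ H * (2*H - 1) := mul_nonneg (by linarith [hH.1]) (by linarith [hH.1])
  have := Real.rpow_le_rpow_of_nonpos (hc.trans hz.1) hz.2.le (by linarith [hH.2] : 2*H - 2 ≤ 0)
  gcongr

lemma mul_le_det {H ε a b c : ℝ} (hH : H ∈ Ioo (1/2 : ℝ) 1) (hε : 0 < ε) (ha : 0 < a)
    (hb : 0 < b) (hc : 0 < c) :
    (1 - (2 - 1/H) ^ 2) * ((ε + a ^ (2*H)) * (ε + b ^ (2*H))) ≤
      (ε + a ^ (2*H)) * (ε + b ^ (2*H)) - mu H (a + c) a b ^ 2 := by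
  have hm := pow_le_pow_left₀ (mu_nonneg hH.1.le ha hb hc) (mu_le_mul_rpow hH ha hb hc) 2
  have hsq : ∀ x : ℝ, 0 < x → x ^ (2*H) = (x ^ H) ^ 2 := fun x hx => by
    rw [mul_comm, Real.rpow_mul hx.le, Real.rpow_two]
  rw [hsq a ha, hsq b hb]
  have hle : (a ^ H * b ^ H) ^ 2 ≤ (ε + (a ^ H) ^ 2) * (ε + (b ^ H) ^ 2) := by
    nlinarith [mul_pos hε hε, mul_nonneg hε.le (sq_nonneg (a ^ H)),
      mul_nonneg hε.le (sq_nonneg (b ^ H))]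
  nlinarith [mul_le_mul_of_nonneg_left hle (sq_nonneg (2 - 1/H))]

lemma one_sub_sq_pos {H : ℝ} (hH : H ∈ Ioo (1/2 : ℝ) 1) : 0 < 1 - (2 - 1/H) ^ 2 := by
  have hH0 : 0 < H := by linarith [hH.1]
  have h1 : 1 < 1/H := by rw [lt_div_iff₀ hH0]; linarith [hH.2]
  have h2 : 1/H < 2 := by rw [div_lt_iff₀ hH0]; linarith [hH.1]
  nlinarith

/-- The integrand of `V3` at `ε = η ^ (2 * H)`, for increments of lengths `η * u` and `η * v`
separated by a gap `c`, multiplied by `η ^ (6 * H - 2)`. -/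
noncomputable def rescaledIntegrand (H η u v c : ℝ) : ℝ :=
  ((1 + u ^ (2*H)) * (1 + v ^ (2*H)) - (mu H (η*u + c) (η*u) (η*v) / η ^ (2*H)) ^ 2) ^
    (-(3/2 : ℝ)) * (mu H (η*u + c) (η*u) (η*v) / η ^ 2)

lemma mul_le_rescaled_det {H η u v c : ℝ} (hH : H ∈ Ioo (1/2 : ℝ) 1) (hη : 0 < η) (hu : 0 < u)
    (hv : 0 < v) (hc : 0 < c) :
    (1 - (2 - 1/H) ^ 2) * ((1 + u ^ (2*H)) * (1 + v ^ (2*H))) ≤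
      (1 + u ^ (2*H)) * (1 + v ^ (2*H)) -
        (mu H (η*u + c) (η*u) (η*v) / η ^ (2*H)) ^ 2 := by
  have hε : 0 < η ^ (2*H) := by positivity
  have h := mul_le_det hH hε (mul_pos hη hu) (mul_pos hη hv) hc
  rw [Real.mul_rpow hη.le hu.le, Real.mul_rpow hη.le hv.le] at h
  refine le_of_mul_le_mul_right ?_ (pow_pos hε 2)
  refine (le_of_eq ?_).trans (h.trans_eq ?_)
  · ring
  · field_simp

lemma rpow_mul_integrand_eq {H η u v c : ℝ} (hH : H ∈ Ioo (1/2 : ℝ) 1) (hη : 0 < η)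
    (hu : 0 < u) (hv : 0 < v) (hc : 0 < c) :
    η ^ (6*H - 2) * (((η ^ (2*H) + (η*u) ^ (2*H)) * (η ^ (2*H) + (η*v) ^ (2*H)) -
      mu H (η*u + c) (η*u) (η*v) ^ 2) ^ (-(3/2 : ℝ)) * mu H (η*u + c) (η*u) (η*v)) =
      rescaledIntegrand H η u v c := by
  have hε : 0 < η ^ (2*H) := by positivity
  have hdet : 0 ≤ (1 + u ^ (2*H)) * (1 + v ^ (2*H)) -
      (mu H (η*u + c) (η*u) (η*v) / η ^ (2*H)) ^ 2 :=
    le_trans (mul_nonneg (one_sub_sq_pos hH).le (by positivity))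
      (mul_le_rescaled_det hH hη hu hv hc)
  have hfactor : (η ^ (2*H) + (η*u) ^ (2*H)) * (η ^ (2*H) + (η*v) ^ (2*H)) -
      mu H (η*u + c) (η*u) (η*v) ^ 2 = (η ^ (2*H)) ^ 2 * ((1 + u ^ (2*H)) * (1 + v ^ (2*H)) -
      (mu H (η*u + c) (η*u) (η*v) / η ^ (2*H)) ^ 2) := by
    rw [Real.mul_rpow hη.le hu.le, Real.mul_rpow hη.le hv.le]
    field_simp
  have hpow : η ^ (6*H - 2) * ((η ^ (2*H)) ^ 2) ^ (-(3/2 : ℝ)) = (η ^ 2)⁻¹ := by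
    rw [← Real.rpow_natCast, ← Real.rpow_natCast, ← Real.rpow_mul hη.le, ← Real.rpow_mul hη.le,
      ← Real.rpow_add hη, ← Real.rpow_neg hη.le]
    congr 1
    push_cast
    ring
  rw [hfactor, Real.mul_rpow (by positivity) hdet, rescaledIntegrand, div_eq_mul_inv _ (η ^ 2),
    ← hpow]
  ring

lemma norm_rescaledIntegrand_le {H η u v c : ℝ} (hH : H ∈ Ioo (1/2 : ℝ) 1) (hη : 0 < η)
    (hu : 0 < u) (hv : 0 < v) (hc : 0 < c) :
    ‖rescaledIntegrand H η u v c‖ ≤ (1 - (2 - 1/H) ^ 2) ^ (-(3/2 : ℝ)) * (H * (2*H - 1)) *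
      (u * (1 + u ^ (2*H)) ^ (-(3/2 : ℝ)) * (v * (1 + v ^ (2*H)) ^ (-(3/2 : ℝ)) *
        c ^ (2*H - 2))) := by
  have hk := one_sub_sq_pos hH
  have hdet := mul_le_rescaled_det hH hη hu hv hc
  have hpos : 0 < (1 - (2 - 1/H) ^ 2) * ((1 + u ^ (2*H)) * (1 + v ^ (2*H))) :=
    mul_pos hk (by positivity)
  have hm := mu_nonneg hH.1.le (mul_pos hη hu) (mul_pos hη hv) hc
  have hm' : mu H (η*u + c) (η*u) (η*v) / η ^ 2 ≤ u * v * (H * (2*H - 1) * c ^ (2*H - 2)) := by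
    rw [div_le_iff₀ (by positivity)]
    refine (mu_le_mul_gap hH (mul_pos hη hu) (mul_pos hη hv) hc).trans_eq ?_
    ring
  have hrpow := Real.rpow_le_rpow_of_nonpos hpos hdet (by norm_num : -(3/2 : ℝ) ≤ 0)
  rw [rescaledIntegrand, Real.norm_of_nonneg (mul_nonneg (Real.rpow_nonneg (hpos.le.trans hdet) _)
    (div_nonneg hm (by positivity)))]
  refine (mul_le_mul hrpow hm' (div_nonneg hm (by positivity))
    (Real.rpow_nonneg hpos.le _)).trans_eq ?_
  rw [Real.mul_rpow hk.le (by positivity), Real.mul_rpow (by positivity) (by positivity)]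
  ring

lemma tendsto_rescaledIntegrand {H u v c : ℝ} (hH : H ∈ Ioo (1/2 : ℝ) 1) (hu : 0 < u)
    (hv : 0 < v) (hc : 0 < c) :
    Tendsto (fun η => rescaledIntegrand H η u v c) (nhdsWithin 0 (Ioi 0))
      (nhds (H * (2*H - 1) * (u * (1 + u ^ (2*H)) ^ (-(3/2 : ℝ)) *
        (v * (1 + v ^ (2*H)) ^ (-(3/2 : ℝ)) * c ^ (2*H - 2))))) := by
  have hcov : Tendsto (fun η => mu H (η*u + c) (η*u) (η*v) / η ^ 2) (nhdsWithin 0 (Ioi 0))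
      (nhds (u * v * (H * (2*H - 1) * c ^ (2*H - 2)))) := by
    have hlow : Tendsto (fun η : ℝ => u * v * (H * (2*H - 1) * (c + η*u + η*v) ^ (2*H - 2)))
        (nhdsWithin 0 (Ioi 0)) (nhds (u * v * (H * (2*H - 1) * c ^ (2*H - 2)))) := by
      have hgap : ContinuousAt (fun η : ℝ => c + η*u + η*v) 0 := by fun_prop
      have : ContinuousAt (fun η : ℝ => u * v * (H * (2*H - 1) * (c + η*u + η*v) ^ (2*H - 2))) 0 :=
        continuousAt_const.mul (continuousAt_const.mul
          (hgap.rpow_const (Or.inl (by simpa using hc.ne'))))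
      simpa using this.tendsto.mono_left nhdsWithin_le_nhds
    refine tendsto_of_tendsto_of_tendsto_of_le_of_le' hlow tendsto_const_nhds ?_ ?_
    · filter_upwards [self_mem_nhdsWithin] with η hη
      have hη : 0 < η := hη
      rw [le_div_iff₀ (by positivity)]
      refine le_trans (le_of_eq ?_) (le_mu_mul_gap hH (mul_pos hη hu) (mul_pos hη hv) hc)
      ring
    · filter_upwards [self_mem_nhdsWithin] with η hη
      have hη : 0 < η := hη
      rw [div_le_iff₀ (by positivity)]
      refine (mu_le_mul_gap hH (mul_pos hη hu) (mul_pos hη hv) hc).trans_eq ?_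
      ring
  have hsmall : Tendsto (fun η => mu H (η*u + c) (η*u) (η*v) / η ^ (2*H))
      (nhdsWithin 0 (Ioi 0)) (nhds 0) := by
    have hpow : Tendsto (fun η : ℝ => η ^ (2 - 2*H)) (nhdsWithin 0 (Ioi 0)) (nhds 0) := by
      have := (Real.continuousAt_rpow_const 0 (2 - 2*H)
        (Or.inr (by linarith [hH.2]))).tendsto.mono_left (nhdsWithin_le_nhds (s := Ioi 0))
      rwa [Real.zero_rpow (by linarith [hH.2])] at this
    have h := hcov.mul hpow
    rw [mul_zero] at h
    refine h.congr' ?_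
    filter_upwards [self_mem_nhdsWithin] with η hη
    have hη : 0 < η := hη
    rw [Real.rpow_sub hη, Real.rpow_two]
    field_simp
  have hbase : Tendsto (fun η => (1 + u ^ (2*H)) * (1 + v ^ (2*H)) -
      (mu H (η*u + c) (η*u) (η*v) / η ^ (2*H)) ^ 2) (nhdsWithin 0 (Ioi 0))
      (nhds ((1 + u ^ (2*H)) * (1 + v ^ (2*H)))) := by
    simpa using (hsmall.pow 2).const_sub ((1 + u ^ (2*H)) * (1 + v ^ (2*H)))
  have hne : (1 + u ^ (2*H)) * (1 + v ^ (2*H)) ≠ 0 := by positivity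
  have h := (hbase.rpow_const (p := -(3/2 : ℝ)) (Or.inl hne)).mul hcov
  rw [Real.mul_rpow (by positivity) (by positivity)] at h
  simp only [rescaledIntegrand]
  convert h using 2
  ring

lemma measurePreserving_gaps_s8 :
    MeasurePreserving (fun q : ℝ × ℝ × ℝ × ℝ =>
      (q.2.2.2, q.2.2.2 + q.1 + q.2.2.1, q.2.2.2 + q.1, q.2.2.2 + q.1 + q.2.2.1 + q.2.1)) := by
  have hreorder : MeasurePreserving (fun q : ℝ × ℝ × ℝ × ℝ => (q.2.2.2, q.2.2.1, q.1, q.2.1)) := by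
    have h1 := (volume_preserving_prodAssoc (α₁ := ℝ) (β₁ := ℝ) (γ₁ := ℝ × ℝ)).symm
    have h2 := Measure.measurePreserving_swap (μ := (volume : Measure (ℝ × ℝ)))
      (ν := (volume : Measure (ℝ × ℝ)))
    have h3 := (Measure.measurePreserving_swap (μ := (volume : Measure ℝ))
      (ν := (volume : Measure ℝ))).prod (MeasurePreserving.id (volume : Measure (ℝ × ℝ)))
    have h4 := volume_preserving_prodAssoc (α₁ := ℝ) (β₁ := ℝ) (γ₁ := ℝ × ℝ)
    exact h4.comp (h3.comp (h2.comp h1))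
  have hfirst : MeasurePreserving (fun q : ℝ × ℝ × ℝ × ℝ =>
      (q.1, q.2.1, q.1 + q.2.2.1, q.2.2.2)) :=
    (MeasurePreserving.id (volume : Measure ℝ)).skew_product
      (g := fun (s : ℝ) (r : ℝ × ℝ × ℝ) => (r.1, s + r.2.1, r.2.2)) (by fun_prop)
      (Eventually.of_forall fun s => ((MeasurePreserving.id volume).prod
        ((measurePreserving_add_left volume s).prod (MeasurePreserving.id volume))).map_eq)
  have hsecond : MeasurePreserving (fun q : ℝ × ℝ × ℝ × ℝ =>
      (q.1, q.2.2.1 + q.2.1, q.2.2.1, q.2.2.2)) := by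
    have hskew : MeasurePreserving (fun r : (ℝ × ℝ) × ℝ => (r.1, r.1.1 + r.2)) :=
      (MeasurePreserving.id (volume : Measure (ℝ × ℝ))).skew_product
        (g := fun (r : ℝ × ℝ) (c : ℝ) => r.1 + c) (by fun_prop)
        (Eventually.of_forall fun r => (measurePreserving_add_left volume r.1).map_eq)
    have h1 := Measure.measurePreserving_swap (μ := (volume : Measure ℝ))
      (ν := (volume : Measure (ℝ × ℝ)))
    have h2 := Measure.measurePreserving_swap (μ := (volume : Measure (ℝ × ℝ)))
      (ν := (volume : Measure ℝ))
    exact (MeasurePreserving.id (volume : Measure ℝ)).prod (h2.comp (hskew.comp h1))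
  have hthird : MeasurePreserving (fun q : ℝ × ℝ × ℝ × ℝ =>
      (q.1, q.2.1, q.2.2.1, q.2.1 + q.2.2.2)) :=
    (MeasurePreserving.id (volume : Measure ℝ)).prod
      ((MeasurePreserving.id (volume : Measure ℝ)).skew_product
        (g := fun (s : ℝ) (r : ℝ × ℝ) => (r.1, s + r.2)) (by fun_prop)
        (Eventually.of_forall fun s => ((MeasurePreserving.id volume).prod
          (measurePreserving_add_left volume s)).map_eq))
  exact hthird.comp (hsecond.comp (hfirst.comp hreorder))

lemma integral_eq_sq_mul_integral_gaps {η : ℝ} (hη : 0 < η) {F : ℝ × ℝ × ℝ × ℝ → ℝ}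
    (hF : Measurable F) :
    ∫ p, F p = η ^ 2 * ∫ q : ℝ × ℝ × ℝ × ℝ, F (q.2.2.2, q.2.2.2 + η * q.1 + q.2.2.1,
      q.2.2.2 + η * q.1, q.2.2.2 + η * q.1 + q.2.2.1 + η * q.2.1) := by
  have hinner : Measure.map (Prod.map (η * ·) (id : ℝ × ℝ → ℝ × ℝ)) volume =
      ENNReal.ofReal η⁻¹ • (volume : Measure (ℝ × ℝ × ℝ)) := by
    rw [Measure.volume_eq_prod, ← Measure.map_prod_map _ _ (measurable_const_mul η) measurable_id,
      Real.map_volume_mul_left hη.ne', Measure.map_id, Measure.prod_smul_left,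
      abs_of_pos (inv_pos.2 hη)]
  have hscale : Measure.map (Prod.map (η * ·) (Prod.map (η * ·) (id : ℝ × ℝ → ℝ × ℝ))) volume =
      ENNReal.ofReal η⁻¹ • ENNReal.ofReal η⁻¹ • (volume : Measure (ℝ × ℝ × ℝ × ℝ)) := by
    rw [Measure.volume_eq_prod, ← Measure.map_prod_map _ _ (measurable_const_mul η)
      ((measurable_const_mul η).prodMap measurable_id), hinner,
      Real.map_volume_mul_left hη.ne', Measure.prod_smul_left, Measure.prod_smul_right,
      abs_of_pos (inv_pos.2 hη)]
  have hFgaps := hF.comp measurePreserving_gaps_s8.measurable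
  have h := integral_map (μ := volume) (φ := Prod.map (η * ·) (Prod.map (η * ·) id))
    (by fun_prop) hFgaps.aestronglyMeasurable
  rw [hscale, integral_smul_measure, integral_smul_measure,
    ENNReal.toReal_ofReal (inv_pos.2 hη).le] at h
  have h' := integral_map (μ := volume) measurePreserving_gaps_s8.measurable.aemeasurable
    hF.aestronglyMeasurable
  rw [measurePreserving_gaps_s8.map_eq] at h'
  simp only [Function.comp_def, Prod.map, id, smul_eq_mul] at h
  rw [h', ← h]
  field_simp

lemma measurableSet_regS3 (T : ℝ) : MeasurableSet (regS3 T) := by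
  unfold regS3
  simp only [mem_Icc]
  measurability

/-- The integrand in the definition of `V3`. -/
noncomputable def V3Integrand (H ε : ℝ) (p : ℝ × ℝ × ℝ × ℝ) : ℝ :=
  ((ε + (p.2.2.1 - p.1) ^ (2*H)) * (ε + (p.2.2.2 - p.2.1) ^ (2*H)) -
      mu H (p.2.1 - p.1) (p.2.2.1 - p.1) (p.2.2.2 - p.2.1) ^ 2) ^ (-(3/2 : ℝ)) *
    mu H (p.2.1 - p.1) (p.2.2.1 - p.1) (p.2.2.2 - p.2.1)

lemma measurable_V3Integrand (H ε : ℝ) : Measurable (V3Integrand H ε) := by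
  unfold V3Integrand mu
  fun_prop

/-- The point `(s₁, s₂, t₁, t₂)` with `s₁ = s`, `t₁ - s₁ = η * u`, `s₂ - t₁ = c` and
`t₂ - s₂ = η * v`, where `q = (u, v, c, s)`. -/
def gapPoint (η : ℝ) (q : ℝ × ℝ × ℝ × ℝ) : ℝ × ℝ × ℝ × ℝ :=
  (q.2.2.2, q.2.2.2 + η * q.1 + q.2.2.1, q.2.2.2 + η * q.1,
    q.2.2.2 + η * q.1 + q.2.2.1 + η * q.2.1)

lemma V3Integrand_gapPoint (H ε η u v c s : ℝ) :
    V3Integrand H ε (gapPoint η (u, v, c, s)) =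
      ((ε + (η*u) ^ (2*H)) * (ε + (η*v) ^ (2*H)) - mu H (η*u + c) (η*u) (η*v) ^ 2) ^
        (-(3/2 : ℝ)) * mu H (η*u + c) (η*u) (η*v) := by
  simp only [V3Integrand, gapPoint]
  rw [show s + η*u + c - s = η*u + c by ring, show s + η*u - s = η*u by ring,
    show s + η*u + c + η*v - (s + η*u + c) = η*v by ring]

lemma gapPoint_mem_regS3_iff {T η u v c s : ℝ} (hη : 0 < η) :
    gapPoint η (u, v, c, s) ∈ regS3 T ↔
      0 ≤ u ∧ 0 ≤ v ∧ 0 ≤ c ∧ 0 ≤ s ∧ s + η*u + c + η*v ≤ T := by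
  simp only [gapPoint, regS3, mem_ofPred_eq, mem_Icc]
  constructor
  · rintro ⟨⟨h1, -⟩, -, -, ⟨-, h2⟩, h3, h4, h5⟩
    exact ⟨nonneg_of_mul_nonneg_right (by linarith) hη,
      nonneg_of_mul_nonneg_right (by linarith) hη, by linarith, h1, h2⟩
  · rintro ⟨hu, hv, hc, hs, hT⟩
    have := mul_nonneg hη.le hu
    have := mul_nonneg hη.le hv
    refine ⟨⟨?_, ?_⟩, ⟨?_, ?_⟩, ⟨?_, ?_⟩, ⟨?_, ?_⟩, ?_, ?_, ?_⟩ <;> linarith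

lemma rpow_mul_V3_eq (H T : ℝ) {η : ℝ} (hη : 0 < η) :
    η ^ (6*H - 4) * V3 H T (η ^ (2*H)) = (1/π) * ∫ q : ℝ × ℝ × ℝ × ℝ,
      η ^ (6*H - 2) * (regS3 T).indicator (V3Integrand H (η ^ (2*H))) (gapPoint η q) := by
  have hV : V3 H T (η ^ (2*H)) = (1/π) * ∫ p in regS3 T, V3Integrand H (η ^ (2*H)) p := rfl
  rw [hV, ← integral_indicator (measurableSet_regS3 T), integral_eq_sq_mul_integral_gaps hη
    ((measurable_V3Integrand H _).indicator (measurableSet_regS3 T)), integral_const_mul,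
    show 6*H - 2 = 6*H - 4 + 2 by ring, Real.rpow_add hη, Real.rpow_two]
  simp only [gapPoint]
  ring

lemma integrableOn_mul_one_add_rpow {H : ℝ} (hH : 2/3 < H) :
    IntegrableOn (fun u : ℝ => u * (1 + u ^ (2*H)) ^ (-(3/2 : ℝ))) (Ioi 0) := by
  have hcont : ContinuousOn (fun u : ℝ => u * (1 + u ^ (2*H)) ^ (-(3/2 : ℝ))) (Ici 0) := by
    intro u hu
    have hu : 0 ≤ u := hu
    have : ContinuousAt (fun u : ℝ => u ^ (2*H)) u :=
      Real.continuousAt_rpow_const _ _ (Or.inr (by linarith))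
    have hne : 1 + u ^ (2*H) ≠ 0 := by positivity
    exact (continuousAt_id.mul ((continuousAt_const.add this).rpow_const
      (Or.inl hne))).continuousWithinAt
  rw [← Ioc_union_Ioi_eq_Ioi zero_le_one]
  refine IntegrableOn.union ?_ ?_
  · exact ((hcont.mono Icc_subset_Ici_self).integrableOn_Icc).mono_set Ioc_subset_Icc_self
  · refine Integrable.mono' (integrableOn_Ioi_rpow_of_lt (by linarith : 1 - 3*H < -1) one_pos)
      ((hcont.mono (Ioi_subset_Ici zero_le_one)).aestronglyMeasurable measurableSet_Ioi) ?_
    refine (ae_restrict_iff' measurableSet_Ioi).2 (Eventually.of_forall fun u hu => ?_)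
    have hu : 0 < u := zero_lt_one.trans hu
    rw [Real.norm_of_nonneg (by positivity)]
    calc u * (1 + u ^ (2*H)) ^ (-(3/2 : ℝ)) ≤ u * (u ^ (2*H)) ^ (-(3/2 : ℝ)) := by
          refine mul_le_mul_of_nonneg_left ?_ hu.le
          exact Real.rpow_le_rpow_of_nonpos (by positivity) (by linarith) (by norm_num)
      _ = u ^ (1 - 3*H) := by
          rw [← Real.rpow_mul hu.le]
          nth_rewrite 1 [← Real.rpow_one u]
          rw [← Real.rpow_add hu]
          ring_nf

lemma image_div_one_add_rpow {q : ℝ} (hq : 0 < q) :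
    (fun u : ℝ => u ^ q / (1 + u ^ q)) '' Ioi 0 = Ioo 0 1 := by
  ext x
  constructor
  · rintro ⟨u, hu, rfl⟩
    have hu : 0 < u := hu
    have : 0 < u ^ q := by positivity
    exact ⟨by positivity, by rw [div_lt_one (by positivity)]; linarith⟩
  · rintro ⟨hx0, hx1⟩
    have h1 : 0 < 1 - x := by linarith
    refine ⟨(x / (1 - x)) ^ q⁻¹, by simp only [mem_Ioi]; positivity, ?_⟩
    simp only
    rw [Real.rpow_inv_rpow (by positivity) hq.ne']
    field_simp
    ring

lemma betaFn_eq_integral_Ioi {H : ℝ} (hH : 0 < H) :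
    betaFn (1/H) ((3*H - 2) / (2*H)) =
      2*H * ∫ u in Ioi (0:ℝ), u * (1 + u ^ (2*H)) ^ (-(3/2 : ℝ)) := by
  have hderiv : ∀ u ∈ Ioi (0:ℝ), HasDerivWithinAt (fun u : ℝ => u ^ (2*H) / (1 + u ^ (2*H)))
      (2*H * u ^ (2*H - 1) / (1 + u ^ (2*H)) ^ 2) (Ioi 0) u := by
    intro u hu
    have hu : 0 < u := hu
    have h := Real.hasDerivAt_rpow_const (x := u) (p := 2*H) (Or.inl hu.ne')
    have := h.div (h.const_add 1) (by positivity)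
    exact (this.congr_deriv (by ring)).hasDerivWithinAt
  have hinj : InjOn (fun u : ℝ => u ^ (2*H) / (1 + u ^ (2*H))) (Ioi 0) := by
    intro u hu v hv huv
    have hu : 0 < u := hu
    have hv : 0 < v := hv
    have hu' : 0 < u ^ (2*H) := by positivity
    have hv' : 0 < v ^ (2*H) := by positivity
    simp only at huv
    rw [div_eq_div_iff (by positivity) (by positivity)] at huv
    exact (Real.rpow_left_inj hu.le hv.le (mul_pos two_pos hH).ne').1 (by linarith)
  rw [betaFn, intervalIntegral.integral_of_le zero_le_one, integral_Ioc_eq_integral_Ioo,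
    ← image_div_one_add_rpow (by positivity : 0 < 2*H),
    integral_image_eq_integral_abs_deriv_smul measurableSet_Ioi hderiv hinj,
    ← integral_const_mul]
  refine setIntegral_congr_fun measurableSet_Ioi fun u hu => ?_
  have hu : 0 < u := hu
  have hw : 0 < 1 + u ^ (2*H) := by positivity
  have hsub : 1 - u ^ (2*H) / (1 + u ^ (2*H)) = (1 + u ^ (2*H))⁻¹ := by field_simp; ring
  simp only [smul_eq_mul]
  rw [hsub, abs_of_nonneg (by positivity), Real.div_rpow (by positivity) hw.le,
    ← Real.rpow_mul hu.le, Real.inv_rpow hw.le]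
  have h1 : (2*H) * (1/H - 1) = 1 - (2*H - 1) := by field_simp; ring
  have h2 : (1 + u ^ (2*H)) ^ ((3*H - 2) / (2*H) - 1) =
      (1 + u ^ (2*H)) ^ (3/2 : ℝ) / ((1 + u ^ (2*H)) ^ (1/H - 1) * (1 + u ^ (2*H)) ^ 2) := by
    rw [← Real.rpow_natCast, ← Real.rpow_add hw, ← Real.rpow_sub hw]
    congr 1
    field_simp
    push_cast
    ring
  rw [h2, Real.rpow_neg hw.le]
  have := (Real.rpow_pos_of_pos hu (2*H - 1)).ne'
  have := (Real.rpow_pos_of_pos hw (1/H - 1)).ne'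
  have := (Real.rpow_pos_of_pos hw (3/2)).ne'
  have h3 : u ^ (2*H - 1) = u ^ (2*H) / u := Real.rpow_sub_one hu.ne' _
  rw [h1, Real.rpow_sub hu 1, Real.rpow_one, h3]
  generalize (1 + u ^ (2*H)) ^ (1/H - 1) = A at *
  generalize (1 + u ^ (2*H)) ^ (3/2 : ℝ) = B at *
  field_simp

lemma integral_sub_mul_rpow_eq_betaFn {T : ℝ} (hT : 0 < T) (H : ℝ) :
    ∫ c in (0:ℝ)..T, (T - c) * c ^ (2*H - 2) = T ^ (2*H) * betaFn 2 (2*H - 1) := by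
  have h := intervalIntegral.integral_comp_sub_mul (a := 0) (b := 1)
    (fun c : ℝ => (T - c) * c ^ (2*H - 2)) hT.ne' T
  simp only [mul_one, sub_self, mul_zero, sub_zero, smul_eq_mul] at h
  have h' : ∫ c in (0:ℝ)..T, (T - c) * c ^ (2*H - 2) =
      T * ∫ x in (0:ℝ)..1, (T - (T - T * x)) * (T - T * x) ^ (2*H - 2) := by
    rw [h]; field_simp
  rw [h', betaFn, ← intervalIntegral.integral_const_mul, ← intervalIntegral.integral_const_mul]
  refine intervalIntegral.integral_congr fun x hx => ?_
  rw [uIcc_of_le zero_le_one] at hx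
  rw [show T - T * x = T * (1 - x) by ring, Real.mul_rpow hT.le (by linarith [hx.2]),
    show (2:ℝ) - 1 = 1 by norm_num, Real.rpow_one, show 2*H - 1 - 1 = 2*H - 2 by ring,
    Real.rpow_sub hT, Real.rpow_two]
  field_simp
  ring

/-- The pairs `(c, s)` with `0 < c`, `0 ≤ s` and `c + s < T`. -/
def gapTriangle (T : ℝ) : Set (ℝ × ℝ) := {r | 0 < r.1 ∧ 0 ≤ r.2 ∧ r.1 + r.2 < T}

/-- The density in `(c, s)` of the limit. -/
noncomputable def gapDensity (H T : ℝ) : ℝ × ℝ → ℝ :=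
  (gapTriangle T).indicator fun r => r.1 ^ (2*H - 2)

lemma measurable_gapDensity (H T : ℝ) : Measurable (gapDensity H T) := by
  refine Measurable.indicator (measurable_fst.pow_const _) ?_
  exact (measurableSet_lt measurable_const measurable_fst).inter
    ((measurableSet_le measurable_const measurable_snd).inter
      (measurableSet_lt (measurable_fst.add measurable_snd) measurable_const))

lemma integrable_gapBound {H : ℝ} (hH : 1/2 < H) (T : ℝ) :
    Integrable (fun r : ℝ × ℝ => (Ioc 0 T).indicator (fun c => c ^ (2*H - 2)) r.1 *
      (Icc 0 T).indicator (fun _ => (1:ℝ)) r.2) := by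
  refine Integrable.mul_prod (f := (Ioc 0 T).indicator (fun c : ℝ => c ^ (2*H - 2)))
    (g := (Icc 0 T).indicator (fun _ => (1:ℝ))) ?_ ?_
  · rw [integrable_indicator_iff measurableSet_Ioc]
    rcases le_total 0 T with hT | hT
    · exact (intervalIntegrable_iff_integrableOn_Ioc_of_le hT).1
        (intervalIntegral.intervalIntegrable_rpow' (by linarith))
    · simp [Ioc_eq_empty_of_le hT]
  · rw [integrable_indicator_iff measurableSet_Icc]
    exact integrableOn_const (by simp)

lemma integral_gapDensity {H T : ℝ} (hH : 1/2 < H) (hT : 0 < T) :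
    ∫ r, gapDensity H T r = T ^ (2*H) * betaFn 2 (2*H - 1) := by
  have hint : Integrable (gapDensity H T) := by
    refine (integrable_gapBound hH T).mono' (measurable_gapDensity H T).aestronglyMeasurable
      (Eventually.of_forall fun r => ?_)
    by_cases hr : r ∈ gapTriangle T
    · have h1 : r.1 ∈ Ioc 0 T := ⟨hr.1, by linarith [hr.2.1, hr.2.2]⟩
      have h2 : r.2 ∈ Icc 0 T := ⟨hr.2.1, by linarith [hr.1, hr.2.2]⟩
      rw [gapDensity, indicator_of_mem hr, indicator_of_mem h1,
        indicator_of_mem h2, mul_one, Real.norm_of_nonneg (Real.rpow_nonneg hr.1.le _)]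
    · rw [gapDensity, indicator_of_notMem hr, norm_zero]
      exact mul_nonneg (indicator_nonneg (fun c hc => Real.rpow_nonneg hc.1.le _) _)
        (indicator_nonneg (fun _ _ => zero_le_one) _)
  have hinner : ∀ c : ℝ, ∫ s, gapDensity H T (c, s) =
      (Ioc 0 T).indicator (fun c => (T - c) * c ^ (2*H - 2)) c := by
    intro c
    by_cases hc : c ∈ Ioc 0 T
    · have : (fun s => gapDensity H T (c, s)) =
          (Ico 0 (T - c)).indicator fun _ => c ^ (2*H - 2) := by
        ext s
        simp only [gapDensity, gapTriangle, indicator_apply, mem_ofPred_eq, mem_Ico, hc.1, true_and,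
          lt_sub_iff_add_lt']
      rw [this, integral_indicator measurableSet_Ico, setIntegral_const, indicator_of_mem hc,
        Real.volume_real_Ico_of_le (by linarith [hc.2]), sub_zero, smul_eq_mul]
    · rw [indicator_of_notMem hc]
      refine integral_eq_zero_of_ae (Eventually.of_forall fun s => ?_)
      refine indicator_of_notMem (fun h => hc ?_) _
      exact ⟨h.1, by linarith [h.2.1, h.2.2]⟩
  rw [Measure.volume_eq_prod, integral_prod _ (by rwa [← Measure.volume_eq_prod])]
  simp only [hinner]
  rw [integral_indicator measurableSet_Ioc, ← intervalIntegral.integral_of_le hT.le,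
    integral_sub_mul_rpow_eq_betaFn hT]

/-- The density in each rescaled increment length of the limit. -/
noncomputable def lengthDensity (H : ℝ) : ℝ → ℝ :=
  (Ioi 0).indicator fun u => u * (1 + u ^ (2*H)) ^ (-(3/2 : ℝ))

lemma integral_lengthDensity {H : ℝ} (hH : 0 < H) :
    ∫ u, lengthDensity H u = betaFn (1/H) ((3*H - 2) / (2*H)) / (2*H) := by
  rw [lengthDensity, integral_indicator measurableSet_Ioi, betaFn_eq_integral_Ioi hH]
  field_simp

lemma integrable_lengthDensity {H : ℝ} (hH : 2/3 < H) : Integrable (lengthDensity H) :=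
  (integrable_indicator_iff measurableSet_Ioi).2 (integrableOn_mul_one_add_rpow hH)

lemma lengthDensity_nonneg (H u : ℝ) : 0 ≤ lengthDensity H u :=
  indicator_nonneg (fun u hu => by
    have hu : 0 < u := hu
    positivity) u

lemma ae_ne_zero_gaps : ∀ᵐ q : ℝ × ℝ × ℝ × ℝ, q.1 ≠ 0 ∧ q.2.1 ≠ 0 ∧ q.2.2.1 ≠ 0 := by
  have h0 : ∀ᵐ x : ℝ, x ≠ 0 := Measure.ae_ne volume 0
  have h1 := (Measure.quasiMeasurePreserving_fst (μ := (volume : Measure ℝ))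
    (ν := (volume : Measure (ℝ × ℝ × ℝ)))).ae h0
  have h2 := (Measure.quasiMeasurePreserving_snd (μ := (volume : Measure ℝ))
    (ν := (volume : Measure (ℝ × ℝ × ℝ)))).ae ((Measure.quasiMeasurePreserving_fst
      (μ := (volume : Measure ℝ)) (ν := (volume : Measure (ℝ × ℝ)))).ae h0)
  have h3 := (Measure.quasiMeasurePreserving_snd (μ := (volume : Measure ℝ))
    (ν := (volume : Measure (ℝ × ℝ × ℝ)))).ae ((Measure.quasiMeasurePreserving_snd
      (μ := (volume : Measure ℝ)) (ν := (volume : Measure (ℝ × ℝ)))).ae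
      ((Measure.quasiMeasurePreserving_fst
        (μ := (volume : Measure ℝ)) (ν := (volume : Measure ℝ))).ae h0))
  filter_upwards [h1, h2, h3] with q hq1 hq2 hq3 using ⟨hq1, hq2, hq3⟩

lemma tendsto_integral_gapPoint (T : ℝ) {H : ℝ} (hH : H ∈ Ioo (2/3 : ℝ) 1) :
    Tendsto (fun η : ℝ => ∫ q : ℝ × ℝ × ℝ × ℝ,
        η ^ (6*H - 2) * (regS3 T).indicator (V3Integrand H (η ^ (2*H))) (gapPoint η q))
      (nhdsWithin 0 (Ioi 0))
      (nhds (∫ q : ℝ × ℝ × ℝ × ℝ, H * (2*H - 1) * (lengthDensity H q.1 *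
        (lengthDensity H q.2.1 * gapDensity H T q.2.2)))) := by
  have hH' : H ∈ Ioo (1/2 : ℝ) 1 := ⟨by linarith [hH.1], hH.2⟩
  have hval : ∀ {η u v c s : ℝ}, 0 < η → u ≠ 0 → v ≠ 0 → c ≠ 0 →
      gapPoint η (u, v, c, s) ∈ regS3 T →
      (0 < u ∧ 0 < v ∧ 0 < c) ∧
      η ^ (6*H - 2) * (regS3 T).indicator (V3Integrand H (η ^ (2*H))) (gapPoint η (u, v, c, s)) =
        rescaledIntegrand H η u v c := by
    intro η u v c s hη hu hv hc hmem
    obtain ⟨hu', hv', hc', -⟩ := (gapPoint_mem_regS3_iff hη).1 hmem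
    have hu := hu'.lt_of_ne' hu
    have hv := hv'.lt_of_ne' hv
    have hc := hc'.lt_of_ne' hc
    rw [indicator_of_mem hmem, V3Integrand_gapPoint, rpow_mul_integrand_eq hH' hη hu hv hc]
    exact ⟨⟨hu, hv, hc⟩, rfl⟩
  refine tendsto_integral_filter_of_dominated_convergence
    (fun q => (1 - (2 - 1/H) ^ 2) ^ (-(3/2 : ℝ)) * (H * (2*H - 1)) * (lengthDensity H q.1 *
      (lengthDensity H q.2.1 * ((Ioc 0 T).indicator (fun c => c ^ (2*H - 2)) q.2.2.1 *
        (Icc 0 T).indicator (fun _ => (1:ℝ)) q.2.2.2)))) ?_ ?_ ?_ ?_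
  · refine Eventually.of_forall fun η => ?_
    have : Measurable (gapPoint η) := by unfold gapPoint; fun_prop
    exact ((((measurable_V3Integrand H _).indicator (measurableSet_regS3 T)).comp
      this).const_mul _).aestronglyMeasurable
  · filter_upwards [self_mem_nhdsWithin] with η hη
    have hη : 0 < η := hη
    filter_upwards [ae_ne_zero_gaps] with ⟨u, v, c, s⟩ ⟨hu, hv, hc⟩
    by_cases hmem : gapPoint η (u, v, c, s) ∈ regS3 T
    · obtain ⟨⟨hu, hv, hc⟩, h⟩ := hval hη hu hv hc hmem
      obtain ⟨-, -, -, hs, hsT⟩ := (gapPoint_mem_regS3_iff hη).1 hmem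
      have hηu := mul_pos hη hu
      have hηv := mul_pos hη hv
      have hcT : c ∈ Ioc 0 T := ⟨hc, by linarith⟩
      have hsT : s ∈ Icc 0 T := ⟨hs, by linarith⟩
      rw [h]
      simp only [lengthDensity]
      rw [indicator_of_mem (mem_Ioi.2 hu), indicator_of_mem (mem_Ioi.2 hv),
        indicator_of_mem hcT, indicator_of_mem hsT, mul_one]
      exact norm_rescaledIntegrand_le hH' hη hu hv hc
    · rw [indicator_of_notMem hmem, mul_zero, norm_zero]
      have hK : 0 ≤ (1 - (2 - 1/H) ^ 2) ^ (-(3/2 : ℝ)) * (H * (2*H - 1)) :=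
        mul_nonneg (Real.rpow_nonneg (one_sub_sq_pos hH').le _)
          (mul_nonneg (by linarith [hH.1]) (by linarith [hH.1]))
      exact mul_nonneg hK (mul_nonneg (lengthDensity_nonneg _ _)
        (mul_nonneg (lengthDensity_nonneg _ _) (mul_nonneg
          (indicator_nonneg (fun c hc => Real.rpow_nonneg hc.1.le _) _)
          (indicator_nonneg (fun _ _ => zero_le_one) _))))
  · exact ((integrable_lengthDensity hH.1).mul_prod ((integrable_lengthDensity hH.1).mul_prod
      (integrable_gapBound hH'.1 T))).const_mul _
  · filter_upwards [ae_ne_zero_gaps] with ⟨u, v, c, s⟩ ⟨hu, hv, hc⟩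
    simp only at hu hv hc
    by_cases hmem : (0 < u ∧ 0 < v ∧ 0 < c ∧ 0 ≤ s) ∧ c + s < T
    · obtain ⟨⟨hu', hv', hc', hs⟩, hcs⟩ := hmem
      have hlim := tendsto_rescaledIntegrand hH' hu' hv' hc'
      simp only [lengthDensity, gapDensity]
      rw [indicator_of_mem (mem_Ioi.2 hu'), indicator_of_mem (mem_Ioi.2 hv'),
        indicator_of_mem (show (c, s) ∈ gapTriangle T from ⟨hc', hs, hcs⟩)]
      refine hlim.congr' ?_
      have hend : ∀ᶠ η : ℝ in nhdsWithin 0 (Ioi 0), s + η*u + c + η*v < T := by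
        have : ContinuousAt (fun η : ℝ => s + η*u + c + η*v) 0 := by fun_prop
        refine (this.eventually_lt continuousAt_const ?_).filter_mono nhdsWithin_le_nhds
        simpa [add_comm] using hcs
      filter_upwards [self_mem_nhdsWithin, hend] with η hη hηT
      exact (hval hη hu hv hc ((gapPoint_mem_regS3_iff hη).2
        ⟨hu'.le, hv'.le, hc'.le, hs, hηT.le⟩)).2.symm
    · have hzero : lengthDensity H u * (lengthDensity H v * gapDensity H T (c, s)) = 0 := by
        by_cases hu' : 0 < u
        · by_cases hv' : 0 < v
          · have : gapDensity H T (c, s) = 0 :=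
              indicator_of_notMem (fun h => hmem ⟨⟨hu', hv', h.1, h.2.1⟩, h.2.2⟩) _
            rw [this, mul_zero, mul_zero]
          · rw [lengthDensity, indicator_of_notMem (s := Ioi 0) (a := v) hv', zero_mul, mul_zero]
        · rw [lengthDensity, indicator_of_notMem (s := Ioi 0) (a := u) hu', zero_mul]
      simp only [hzero, mul_zero]
      refine tendsto_const_nhds.congr' ?_
      filter_upwards [self_mem_nhdsWithin] with η hη
      have hη : 0 < η := hη
      rw [indicator_of_notMem, mul_zero]
      intro h
      obtain ⟨⟨hu', hv', hc'⟩, -⟩ := hval hη hu hv hc h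
      obtain ⟨-, -, -, hs, hsT⟩ := (gapPoint_mem_regS3_iff hη).1 h
      exact hmem ⟨⟨hu', hv', hc', hs⟩, by linarith [mul_pos hη hu', mul_pos hη hv']⟩

/-- For `2/3 < H < 1`, `ε^{3 - 2/H} V₃(ε) → σ²` as `ε → 0⁺`, where
`σ² = T^{2H}(2H-1)/(4Hπ) · B(1/H, (3H-2)/(2H))² · B(2, 2H-1)`. -/
theorem tendsto_V3 (T : ℝ) (hT : 0 < T) (H : ℝ) (hH : H ∈ Ioo (2/3 : ℝ) 1) :
    Tendsto (fun ε : ℝ => ε ^ (3 - 2/H) * V3 H T ε) (nhdsWithin 0 (Ioi 0))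
      (nhds (T ^ (2*H) * (2*H - 1) / (4*H*π) *
        betaFn (1/H) ((3*H - 2) / (2*H)) ^ 2 * betaFn 2 (2*H - 1))) := by
  have hH0 : 0 < H := by linarith [hH.1]
  have hη : Tendsto (fun ε : ℝ => ε ^ (1/(2*H))) (nhdsWithin 0 (Ioi 0))
      (nhdsWithin 0 (Ioi 0)) := by
    refine tendsto_nhdsWithin_iff.2 ⟨?_, ?_⟩
    · have := (Real.continuousAt_rpow_const 0 (1/(2*H))
        (Or.inr (by positivity))).tendsto.mono_left (nhdsWithin_le_nhds (s := Ioi 0))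
      rwa [Real.zero_rpow (by positivity)] at this
    · filter_upwards [self_mem_nhdsWithin] with ε hε
      exact Real.rpow_pos_of_pos hε _
  have hlim := ((tendsto_integral_gapPoint T hH).comp hη).const_mul (1/π)
  have hvalue : (1/π) * ∫ q : ℝ × ℝ × ℝ × ℝ, H * (2*H - 1) * (lengthDensity H q.1 *
      (lengthDensity H q.2.1 * gapDensity H T q.2.2)) =
      T ^ (2*H) * (2*H - 1) / (4*H*π) *
        betaFn (1/H) ((3*H - 2) / (2*H)) ^ 2 * betaFn 2 (2*H - 1) := by
    rw [integral_const_mul, Measure.volume_eq_prod, integral_prod_mul (lengthDensity H)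
      (fun r : ℝ × ℝ × ℝ => lengthDensity H r.1 * gapDensity H T r.2), Measure.volume_eq_prod,
      integral_prod_mul (lengthDensity H) (gapDensity H T), integral_lengthDensity hH0,
      integral_gapDensity (by linarith [hH.1]) hT]
    field_simp
    ring
  rw [hvalue] at hlim
  refine hlim.congr' ?_
  filter_upwards [self_mem_nhdsWithin] with ε hε
  have hε : 0 < ε := hε
  simp only [Function.comp_apply]
  rw [← rpow_mul_V3_eq H T (Real.rpow_pos_of_pos hε _), ← Real.rpow_mul hε.le,
    ← Real.rpow_mul hε.le, one_div_mul_cancel (by positivity), Real.rpow_one]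
  congr 2
  field_simp
  ring
end
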